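/- arXiv:math/9907032 — 8 statements merged into one kernel-verified Lean document; each statement's English description precedes it below -/
import Mathlib

section
/- Let combinatorial triangulation data be given and let Δ : E → (0, π] satisfy Conditions (2.1) and (2.2). Let 𝓕 ⊊ F be a nonempty proper set of faces, and let Σ_∂𝓕 = Σ_{e ∈ E(𝓕) ∩ E(F∖𝓕)} Δ(e) be the sum of Δ over the relative boundary edges of 𝓕 (edges that are edges both of a face in 𝓕 and of a face not in 𝓕). Then 0 < excess(𝓕) < Σ_∂𝓕. -/
open Finset Real

/-- The set `E(𝓕)` of edges of faces of `𝓕`. -/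
def edgesOfFaces {F E C : Type} [Fintype C] [Fintype E] [DecidableEq F] [DecidableEq E]
    (f : C → F) (o : C → E) (𝓕 : Finset F) : Finset E :=
  Finset.univ.filter (fun e => ∃ c, f c ∈ 𝓕 ∧ o c = e)

/-- The excess of a set of faces: `excess(𝓕) = (Σ_{e ∈ E(𝓕)} Δ(e)) − π·|𝓕|`. -/
noncomputable def excess {F E C : Type} [Fintype C] [Fintype E] [DecidableEq F] [DecidableEq E]
    (f : C → F) (o : C → E) (Δ : E → ℝ) (𝓕 : Finset F) : ℝ :=
  (∑ e ∈ edgesOfFaces f o 𝓕, Δ e) - π * 𝓕.card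

theorem edgesOfFaces_union {F E C : Type} [Fintype C] [Fintype E] [DecidableEq F] [DecidableEq E]
    (f : C → F) (o : C → E) (𝓐 𝓑 : Finset F) :
    edgesOfFaces f o (𝓐 ∪ 𝓑) = edgesOfFaces f o 𝓐 ∪ edgesOfFaces f o 𝓑 := by
  ext e
  simp only [edgesOfFaces, Finset.mem_filter, Finset.mem_univ, true_and, Finset.mem_union,
    or_and_right, exists_or]

/-- Inclusion–exclusion for the excess of two disjoint sets of faces. -/
theorem excess_add_excess_of_disjoint {F E C : Type} [Fintype C] [Fintype E] [DecidableEq F]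
    [DecidableEq E] (f : C → F) (o : C → E) (Δ : E → ℝ) {𝓐 𝓑 : Finset F} (h : Disjoint 𝓐 𝓑) :
    excess f o Δ 𝓐 + excess f o Δ 𝓑 =
      excess f o Δ (𝓐 ∪ 𝓑) + ∑ e ∈ edgesOfFaces f o 𝓐 ∩ edgesOfFaces f o 𝓑, Δ e := by
  have hsum := Finset.sum_union_inter (f := Δ) (s₁ := edgesOfFaces f o 𝓐)
    (s₂ := edgesOfFaces f o 𝓑)
  simp only [excess, edgesOfFaces_union, Finset.card_union_of_disjoint h, Nat.cast_add]
  linarith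

/-- **Lemma 2.5.** If `Δ : E → (0, π]` satisfies Conditions 2.1 and 2.2, then for every
nonempty proper set of faces `𝓕 ⊊ F`, the excess of `𝓕` is strictly between `0` and the
sum of `Δ` over the relative boundary edges of `𝓕`. -/
theorem excess_lt_boundary_sum
    (F E C : Type) [Fintype F] [Fintype E] [Fintype C]
    [DecidableEq F] [DecidableEq E] [DecidableEq C]
    (f : C → F) (o : C → E)
    (hface : ∀ t : F, (Finset.univ.filter (fun c => f c = t)).card = 3)
    (hedge : ∀ e : E, (Finset.univ.filter (fun c => o c = e)).card = 1 ∨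
                      (Finset.univ.filter (fun c => o c = e)).card = 2)
    (Δ : E → ℝ) (hrange : ∀ e : E, 0 < Δ e ∧ Δ e ≤ π)
    -- Condition 2.1:
    (h21 : ∀ e : E, 0 < Δ e)
    -- Condition 2.2:
    (h22 : (∀ 𝓕 : Finset F, 𝓕.Nonempty → 𝓕 ≠ Finset.univ → 0 < excess f o Δ 𝓕) ∧
           excess f o Δ (Finset.univ : Finset F) = 0)
    (𝓕 : Finset F) (hne : 𝓕.Nonempty) (hproper : 𝓕 ≠ Finset.univ) :
    0 < excess f o Δ 𝓕 ∧
    excess f o Δ 𝓕 < ∑ e ∈ edgesOfFaces f o 𝓕 ∩ edgesOfFaces f o 𝓕ᶜ, Δ e := by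
  have hadd := excess_add_excess_of_disjoint f o Δ (disjoint_compl_right (a := 𝓕))
  rw [Finset.union_compl, h22.2] at hadd
  have hcompl : 0 < excess f o Δ 𝓕ᶜ :=
    h22.1 𝓕ᶜ (Finset.nonempty_iff_ne_empty.2 fun h => hproper (Finset.compl_eq_empty_iff 𝓕 |>.1 h))
      fun h => hne.ne_empty (Finset.compl_eq_univ_iff 𝓕 |>.1 h)
  exact ⟨h22.1 𝓕 hne hproper, by linarith⟩
end

section
/- Let combinatorial triangulation data be given and let Δ : E → ℝ satisfy Conditions (2.1) and (2.2). Then for every u : F → ℝ and v : E → ℝ satisfying u(f(c)) + v(o(c)) ≤ 0 for every corner c ∈ C (i.e., u(t) + v(e) ≤ 0 whenever e is an edge of t, with multiplicity), the dual objective satisfies π·Σ_{t ∈ F} u(t) + Σ_{e ∈ E} Δ(e)·v(e) ≤ 0, and equality holds if and only if there is a real number r such that u(t) = r for every face t and v(e) = −r for every edge e. -/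
open Finset Real

section DualObjective

variable {F E C : Type} [Fintype E] [Fintype C] [DecidableEq F] [DecidableEq E]
  {f : C → F} {o : C → E} {Δ : E → ℝ}

theorem mem_edgesOfFaces {𝓕 : Finset F} {e : E} :
    e ∈ edgesOfFaces f o 𝓕 ↔ ∃ c, f c ∈ 𝓕 ∧ o c = e := by
  simp [edgesOfFaces]

variable [Fintype F]

theorem edgesOfFaces_univ (ho : Function.Surjective o) :
    edgesOfFaces f o (Finset.univ : Finset F) = Finset.univ := by
  ext e
  simpa [mem_edgesOfFaces] using ho e

/-- When `u` is constant, the dual objective is a `Δ`-weighted sum of the slacks of `v`. -/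
theorem dual_objective_of_const (ho : Function.Surjective o)
    (hF : excess f o Δ (Finset.univ : Finset F) = 0)
    {u : F → ℝ} {r : ℝ} (hu : ∀ t, u t = r) (v : E → ℝ) :
    π * (∑ t : F, u t) + (∑ e : E, Δ e * v e) = ∑ e : E, Δ e * (v e + r) := by
  rw [excess, edgesOfFaces_univ ho] at hF
  simp only [hu, mul_add, Finset.sum_add_distrib, ← Finset.sum_mul, Finset.sum_const,
    nsmul_eq_mul]
  linear_combination (-r) * hF

/-- Lowering `u` by `d` on `S` and raising `v` by `d` on the edges of `S` changes the dual
objective by `d` times the excess of `S`. -/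
theorem dual_objective_shift (u : F → ℝ) (v : E → ℝ) (d : ℝ) (S : Finset F) :
    π * (∑ t : F, (u t - if t ∈ S then d else 0)) +
        (∑ e : E, Δ e * (v e + if e ∈ edgesOfFaces f o S then d else 0)) =
      π * (∑ t : F, u t) + (∑ e : E, Δ e * v e) + d * excess f o Δ S := by
  simp only [excess, mul_add, Finset.sum_sub_distrib, Finset.sum_add_distrib, mul_ite, mul_zero,
    Finset.sum_ite_mem, Finset.univ_inter, Finset.sum_const, nsmul_eq_mul, ← Finset.sum_mul]
  ring

theorem dual_objective_nonpos_of_const (ho : Function.Surjective o)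
    (hΔ : ∀ e, 0 < Δ e) (hF : excess f o Δ (Finset.univ : Finset F) = 0)
    {u : F → ℝ} {v : E → ℝ} (huv : ∀ c, u (f c) + v (o c) ≤ 0)
    {r : ℝ} (hu : ∀ t, u t = r) :
    π * (∑ t : F, u t) + (∑ e : E, Δ e * v e) ≤ 0 ∧
      (π * (∑ t : F, u t) + (∑ e : E, Δ e * v e) = 0 ↔ ∀ e, v e = -r) := by
  have hslack : ∀ e ∈ (Finset.univ : Finset E), Δ e * (v e + r) ≤ 0 := by
    intro e _
    obtain ⟨c, rfl⟩ := ho e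
    have hc := huv c
    rw [hu] at hc
    exact mul_nonpos_of_nonneg_of_nonpos (hΔ _).le (by linarith)
  rw [dual_objective_of_const ho hF hu]
  refine ⟨Finset.sum_nonpos hslack, ?_⟩
  rw [Finset.sum_eq_zero_iff_of_nonpos hslack]
  simp [(hΔ _).ne', add_eq_zero_iff_eq_neg]

/-- The dual objective is negative at feasible points whose face part is not constant. The proof
lowers the top level set of `u` to the next level until `u` is constant. -/
theorem dual_objective_neg_of_not_const (ho : Function.Surjective o)
    (hΔ : ∀ e, 0 < Δ e)
    (hproper : ∀ 𝓕 : Finset F, 𝓕.Nonempty → 𝓕 ≠ Finset.univ → 0 < excess f o Δ 𝓕)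
    (hF : excess f o Δ (Finset.univ : Finset F) = 0)
    (u : F → ℝ) (v : E → ℝ) (huv : ∀ c, u (f c) + v (o c) ≤ 0)
    (hu : ¬ ∃ r, ∀ t, u t = r) :
    π * (∑ t : F, u t) + (∑ e : E, Δ e * v e) < 0 := by
  induction hn : (Finset.univ.image u).card using Nat.strong_induction_on generalizing u v with
  | _ n ih =>
  have hne : Nonempty F := by
    by_contra h
    exact hu ⟨0, fun t => (h ⟨t⟩).elim⟩
  obtain ⟨top, htop⟩ := Finite.exists_max u
  set S : Finset F := Finset.univ.filter fun t => u t = u top with hS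
  have hmemS : ∀ t, t ∈ S ↔ u t = u top := by simp [hS]
  have hSne : S ≠ Finset.univ := fun h =>
    hu ⟨u top, fun t => (hmemS t).1 (h ▸ Finset.mem_univ t)⟩
  have hScompl : Sᶜ.Nonempty := by
    rwa [Finset.nonempty_iff_ne_empty, Ne, Finset.compl_eq_empty_iff]
  obtain ⟨next, hnextS, hnext⟩ := Finset.exists_max_image Sᶜ u hScompl
  rw [Finset.mem_compl] at hnextS
  have hlt : u next < u top := lt_of_le_of_ne (htop next) fun h => hnextS ((hmemS next).2 h)
  have hexcess := mul_pos (sub_pos.2 hlt) (hproper S ⟨top, (hmemS top).2 rfl⟩ hSne)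
  have hshift := dual_objective_shift (f := f) (o := o) (Δ := Δ) u v (u top - u next) S
  set u' : F → ℝ := fun t => u t - if t ∈ S then u top - u next else 0 with hu'
  set v' : E → ℝ := fun e =>
    v e + if e ∈ edgesOfFaces f o S then u top - u next else 0 with hv'
  have hu'_mem : ∀ t ∈ S, u' t = u next := by
    intro t ht
    simp only [hu', if_pos ht, (hmemS t).1 ht]
    ring
  have hu'_notMem : ∀ t ∉ S, u' t = u t := by
    intro t ht
    simp only [hu', if_neg ht, sub_zero]
  have hu'_le : ∀ t, u' t ≤ u next := by
    intro t
    by_cases ht : t ∈ S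
    · exact (hu'_mem t ht).le
    · exact (hu'_notMem t ht).trans_le (hnext t (Finset.mem_compl.2 ht))
  have huv' : ∀ c, u' (f c) + v' (o c) ≤ 0 := by
    intro c
    by_cases he : o c ∈ edgesOfFaces f o S
    · obtain ⟨c', hc'S, hc'⟩ := mem_edgesOfFaces.1 he
      have hc'uv := huv c'
      rw [(hmemS _).1 hc'S, hc'] at hc'uv
      have hle := hu'_le (f c)
      simp only [hv', if_pos he]
      linarith
    · have hcS : f c ∉ S := fun h => he (mem_edgesOfFaces.2 ⟨c, h, rfl⟩)
      simpa only [hu'_notMem _ hcS, hv', if_neg he, add_zero] using huv c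
  have hnonpos : π * (∑ t : F, u' t) + (∑ e : E, Δ e * v' e) ≤ 0 := by
    by_cases hconst : ∃ r, ∀ t, u' t = r
    · obtain ⟨r, hr⟩ := hconst
      exact (dual_objective_nonpos_of_const ho hΔ hF huv' hr).1
    · refine (ih _ ?_ u' v' huv' hconst rfl).le
      rw [← hn]
      refine Finset.card_lt_card ((Finset.ssubset_iff_of_subset ?_).2
        ⟨u top, Finset.mem_image_of_mem u (Finset.mem_univ top), ?_⟩)
      · intro x hx
        obtain ⟨t, -, rfl⟩ := Finset.mem_image.1 hx
        by_cases ht : t ∈ S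
        · rw [hu'_mem t ht]
          exact Finset.mem_image_of_mem u (Finset.mem_univ next)
        · rw [hu'_notMem t ht]
          exact Finset.mem_image_of_mem u (Finset.mem_univ t)
      · intro hx
        obtain ⟨t, -, ht⟩ := Finset.mem_image.1 hx
        exact absurd (hu'_le t) (by rw [ht]; exact hlt.not_ge)
  linarith

end DualObjective

/-- **Theorem 3.3.** If `Δ` satisfies Conditions 2.1 and 2.2, then for every feasible point
`(u, v)` of the dual linear program `L₁*` (i.e., `u(t) + v(e) ≤ 0` whenever `e` is an edge of
`t`, with multiplicity over corners), the dual objective `π·Σ_t u(t) + Σ_e Δ(e)·v(e)` is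
nonpositive, and it vanishes exactly when `u ≡ r` and `v ≡ −r` for some real `r`. -/
theorem dual_objective_nonpos
    (F E C : Type) [Fintype F] [Fintype E] [Fintype C]
    [DecidableEq F] [DecidableEq E] [DecidableEq C]
    (f : C → F) (o : C → E)
    (hface : ∀ t : F, (Finset.univ.filter (fun c => f c = t)).card = 3)
    (hedge : ∀ e : E, (Finset.univ.filter (fun c => o c = e)).card = 1 ∨
                      (Finset.univ.filter (fun c => o c = e)).card = 2)
    (Δ : E → ℝ)
    -- Condition 2.1:
    (h21 : ∀ e : E, 0 < Δ e)
    -- Condition 2.2: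
    (h22 : (∀ 𝓕 : Finset F, 𝓕.Nonempty → 𝓕 ≠ Finset.univ → 0 < excess f o Δ 𝓕) ∧
           excess f o Δ (Finset.univ : Finset F) = 0)
    (u : F → ℝ) (v : E → ℝ)
    (huv : ∀ c : C, u (f c) + v (o c) ≤ 0) :
    π * (∑ t : F, u t) + (∑ e : E, Δ e * v e) ≤ 0 ∧
    (π * (∑ t : F, u t) + (∑ e : E, Δ e * v e) = 0 ↔
      ∃ r : ℝ, (∀ t : F, u t = r) ∧ (∀ e : E, v e = -r)) := by
  have ho : Function.Surjective o := by
    intro e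
    have hpos : 0 < (Finset.univ.filter (fun c => o c = e)).card := by
      rcases hedge e with h | h <;> omega
    obtain ⟨c, hc⟩ := Finset.card_pos.1 hpos
    exact ⟨c, (Finset.mem_filter.1 hc).2⟩
  by_cases hu : ∃ r, ∀ t, u t = r
  · obtain ⟨r, hr⟩ := hu
    obtain ⟨hle, hiff⟩ := dual_objective_nonpos_of_const ho h21 h22.2 huv hr
    refine ⟨hle, fun h => ⟨r, hr, hiff.1 h⟩, ?_⟩
    rintro ⟨s, hs, hv⟩
    exact (dual_objective_nonpos_of_const ho h21 h22.2 huv hs).2.2 hv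
  · have hneg := dual_objective_neg_of_not_const ho h21 h22.1 h22.2 u v huv hu
    exact ⟨hneg.le, fun h => absurd h hneg.ne, fun ⟨r, hr, _⟩ => absurd ⟨r, hr⟩ hu⟩
end

section
/- Let combinatorial triangulation data be given and let Δ : E → ℝ satisfy Conditions (2.1) and (2.2). Then for every u : F → ℝ and v : E → ℝ satisfying u(f(c)) + v(o(c)) ≤ 0 for every corner c ∈ C, and additionally Σ_{c ∈ C} (u(f(c)) + v(o(c))) ≤ −1 (equivalently, 3·Σ_{t ∈ F} u(t) + 2·Σ_{e interior} v(e) + Σ_{e boundary} v(e) ≤ −1), the objective is strictly negative: π·Σ_{t ∈ F} u(t) + Σ_{e ∈ E} Δ(e)·v(e) < 0. -/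
open Finset Real

/-- A function with at most one value on a nonempty type is constant. -/
theorem exists_eq_const_of_card_image_le_one {F : Type} [Fintype F] [Nonempty F]
    (u : F → ℝ) (hu : (univ.image u).card ≤ 1) : ∃ a, u = fun _ => a :=
  ⟨u (Classical.arbitrary F), funext fun t => card_le_one.1 hu _ (mem_image_of_mem u (mem_univ t))
    _ (mem_image_of_mem u (mem_univ _))⟩

section DualObjective

variable {F E C : Type} [Fintype F] [Fintype E] [Fintype C] [DecidableEq F] [DecidableEq E]

/-- The objective `π·Σ_t u(t) + Σ_e Δ(e)·v(e)` of the dual programs. -/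
noncomputable def dualObjective (Δ : E → ℝ) (u : F → ℝ) (v : E → ℝ) : ℝ :=
  π * (∑ t : F, u t) + ∑ e : E, Δ e * v e

/-- Lowering `u` by `d` on `𝓕` and raising `v` by `d` on the edges of `𝓕` changes the objective
by `d * excess 𝓕`. -/
theorem dualObjective_shift (f : C → F) (o : C → E) (Δ : E → ℝ) (u : F → ℝ) (v : E → ℝ)
    (𝓕 : Finset F) (d : ℝ) :
    dualObjective Δ (fun t => u t - if t ∈ 𝓕 then d else 0)
        (fun e => v e + if e ∈ edgesOfFaces f o 𝓕 then d else 0) =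
      dualObjective Δ u v + d * excess f o Δ 𝓕 := by
  simp only [dualObjective, excess, sum_sub_distrib, mul_add, sum_add_distrib, mul_ite, mul_zero,
    sum_ite_mem, univ_inter, sum_const, nsmul_eq_mul, ← sum_mul]
  ring

/-- If `u` takes at least two values, shifting its top level set down to the next value keeps
feasibility, lowers the number of values of `u` and strictly increases the objective. -/
theorem exists_dualObjective_lt (f : C → F) (o : C → E) (Δ : E → ℝ)
    (hexc : ∀ 𝓕 : Finset F, 𝓕.Nonempty → 𝓕 ≠ Finset.univ → 0 < excess f o Δ 𝓕)
    (u : F → ℝ) (v : E → ℝ) (huv : ∀ c : C, u (f c) + v (o c) ≤ 0)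
    (hu : 1 < (univ.image u).card) :
    ∃ (u' : F → ℝ) (v' : E → ℝ), (∀ c : C, u' (f c) + v' (o c) ≤ 0) ∧
      (univ.image u').card < (univ.image u).card ∧
      dualObjective Δ u v < dualObjective Δ u' v' := by
  have hne : (univ.image u).Nonempty := card_pos.mp (by omega)
  obtain ⟨M, hM, hMmax⟩ := exists_max_image _ id hne
  have hne' : ((univ.image u).erase M).Nonempty :=
    card_pos.mp (by rw [card_erase_of_mem hM]; omega)
  obtain ⟨m, hm, hmmax⟩ := exists_max_image _ id hne'
  simp only [mem_image, mem_univ, true_and, mem_erase, id, forall_exists_index, and_imp,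
    forall_apply_eq_imp_iff, ne_eq] at hM hm hMmax hmmax
  obtain ⟨tM, htM⟩ := hM
  obtain ⟨hmM, tm, htm⟩ := hm
  have hlt : m < M := lt_of_le_of_ne (htm ▸ hMmax tm) hmM
  have hle : ∀ t, u t ≠ M → u t ≤ m := fun t ht => hmmax _ ht t rfl
  let 𝓕 : Finset F := univ.filter (fun t => u t = M)
  have hmem : ∀ t, t ∈ 𝓕 ↔ u t = M := fun t => by simp [𝓕]
  have hpos : 0 < excess f o Δ 𝓕 := by
    refine hexc 𝓕 ⟨tM, (hmem _).2 htM⟩ fun h => hmM ?_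
    rw [← htm]
    exact (hmem tm).1 (h ▸ mem_univ tm)
  refine ⟨fun t => u t - if t ∈ 𝓕 then M - m else 0,
    fun e => v e + if e ∈ edgesOfFaces f o 𝓕 then M - m else 0, fun c => ?_, ?_, ?_⟩
  · by_cases he : o c ∈ edgesOfFaces f o 𝓕
    · obtain ⟨c', hc', hoc⟩ := (mem_filter.1 he).2
      have h1 := huv c'
      rw [(hmem _).1 hc', hoc] at h1
      by_cases hc : u (f c) = M
      · simp only [if_pos he, if_pos ((hmem _).2 hc)]
        linarith
      · simp only [if_pos he, if_neg (mt (hmem _).1 hc)]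
        linarith [hle _ hc]
    · have hc : f c ∉ 𝓕 := fun hc => he (mem_filter.2 ⟨mem_univ _, c, hc, rfl⟩)
      simp only [if_neg he, if_neg hc]
      linarith [huv c]
  · refine card_lt_card ((ssubset_iff_of_subset ?_).2 ⟨M, mem_image.2 ⟨tM, mem_univ _, htM⟩, ?_⟩)
    · intro x hx
      obtain ⟨t, -, rfl⟩ := mem_image.1 hx
      by_cases ht : u t = M
      · exact mem_image.2 ⟨tm, mem_univ _, by simp [hmem, ht, htm]⟩
      · exact mem_image.2 ⟨t, mem_univ _, by simp [hmem, ht]⟩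
    · intro hx
      obtain ⟨t, -, ht⟩ := mem_image.1 hx
      by_cases htM' : u t = M
      · simp only [hmem, htM', if_true] at ht
        linarith
      · simp only [hmem, htM', if_false, sub_zero] at ht
  · rw [dualObjective_shift]
    linarith [mul_pos (sub_pos.2 hlt) hpos]

/-- If `u` is the constant `a`, the objective is `Σ_e Δ(e)·(a + v(e))`. -/
theorem dualObjective_const (f : C → F) (o : C → E) (ho : Function.Surjective o)
    (Δ : E → ℝ) (hexc : excess f o Δ (Finset.univ : Finset F) = 0) (a : ℝ) (v : E → ℝ) :
    dualObjective Δ (fun _ : F => a) v = ∑ e, Δ e * (a + v e) := by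
  have hE : edgesOfFaces f o (Finset.univ : Finset F) = Finset.univ := by
    ext e
    simpa [edgesOfFaces] using ho e
  rw [excess, hE] at hexc
  simp only [dualObjective, mul_add, sum_add_distrib, ← sum_mul, sum_const, nsmul_eq_mul]
  linear_combination -a * hexc

/-- The objective is nonpositive on the feasible region `u(f(c)) + v(o(c)) ≤ 0`. -/
theorem dualObjective_nonpos [Nonempty F] (f : C → F) (o : C → E) (ho : Function.Surjective o)
    (Δ : E → ℝ) (hΔ : ∀ e, 0 < Δ e)
    (hexc : ∀ 𝓕 : Finset F, 𝓕.Nonempty → 𝓕 ≠ Finset.univ → 0 < excess f o Δ 𝓕)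
    (hexc' : excess f o Δ (Finset.univ : Finset F) = 0)
    (u : F → ℝ) (v : E → ℝ) (huv : ∀ c : C, u (f c) + v (o c) ≤ 0) :
    dualObjective Δ u v ≤ 0 := by
  induction hn : (univ.image u).card using Nat.strong_induction_on generalizing u v with
  | _ n ih =>
    rcases Nat.lt_or_ge 1 (univ.image u).card with hu | hu
    · obtain ⟨u', v', hfeas, hcard, hlt⟩ := exists_dualObjective_lt f o Δ hexc u v huv hu
      exact hlt.le.trans (ih _ (hn ▸ hcard) u' v' hfeas rfl)
    · obtain ⟨a, rfl⟩ := exists_eq_const_of_card_image_le_one u hu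
      rw [dualObjective_const f o ho Δ hexc']
      refine sum_nonpos fun e _ => ?_
      obtain ⟨c, rfl⟩ := ho e
      exact mul_nonpos_of_nonneg_of_nonpos (hΔ _).le (huv c)

end DualObjective

/-- **Theorem 3.4.** If `Δ` satisfies Conditions 2.1 and 2.2, then on the feasible region of
the second dual program `L₂*` (the constraints of `L₁*` together with
`Σ_{c ∈ C} (u(f(c)) + v(o(c))) ≤ −1`) the objective `π·Σ_t u(t) + Σ_e Δ(e)·v(e)` is
strictly negative. -/
theorem second_dual_objective_neg
    (F E C : Type) [Fintype F] [Fintype E] [Fintype C]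
    [DecidableEq F] [DecidableEq E] [DecidableEq C]
    (f : C → F) (o : C → E)
    (hface : ∀ t : F, (Finset.univ.filter (fun c => f c = t)).card = 3)
    (hedge : ∀ e : E, (Finset.univ.filter (fun c => o c = e)).card = 1 ∨
                      (Finset.univ.filter (fun c => o c = e)).card = 2)
    (Δ : E → ℝ)
    -- Condition 2.1:
    (h21 : ∀ e : E, 0 < Δ e)
    -- Condition 2.2:
    (h22 : (∀ 𝓕 : Finset F, 𝓕.Nonempty → 𝓕 ≠ Finset.univ → 0 < excess f o Δ 𝓕) ∧
           excess f o Δ (Finset.univ : Finset F) = 0)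
    (u : F → ℝ) (v : E → ℝ)
    (huv : ∀ c : C, u (f c) + v (o c) ≤ 0)
    (hextra : ∑ c : C, (u (f c) + v (o c)) ≤ -1) :
    π * (∑ t : F, u t) + (∑ e : E, Δ e * v e) < 0 := by
  obtain ⟨hexc, hexc'⟩ := h22
  have ho : Function.Surjective o := fun e => by
    obtain ⟨c, hc⟩ : (Finset.univ.filter (fun c => o c = e)).Nonempty :=
      card_pos.mp (by have := hedge e; omega)
    exact ⟨c, (mem_filter.1 hc).2⟩
  obtain ⟨c₀, -, hc₀⟩ : ∃ c ∈ (Finset.univ : Finset C), u (f c) + v (o c) < 0 :=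
    exists_lt_of_sum_lt (by simpa using hextra.trans_lt (by norm_num : (-1 : ℝ) < 0))
  have : Nonempty F := ⟨f c₀⟩
  change dualObjective Δ u v < 0
  rcases Nat.lt_or_ge 1 (univ.image u).card with hu | hu
  · obtain ⟨u', v', hfeas, -, hlt⟩ := exists_dualObjective_lt f o Δ hexc u v huv hu
    exact hlt.trans_le (dualObjective_nonpos f o ho Δ h21 hexc hexc' u' v' hfeas)
  · obtain ⟨a, rfl⟩ := exists_eq_const_of_card_image_le_one u hu
    rw [dualObjective_const f o ho Δ hexc']
    refine sum_neg' (fun e _ => ?_) ⟨o c₀, mem_univ _, mul_neg_of_pos_of_neg (h21 _) hc₀⟩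
    obtain ⟨c, rfl⟩ := ho e
    exact mul_nonpos_of_nonneg_of_nonpos (h21 _).le (huv c)
end

section
/- Let combinatorial triangulation data with vertices be given, in which every edge has two distinct endpoints, and let Δ : E → ℝ with exterior dihedral angles δ′(e) = π − Δ(e). Then for every set of faces 𝓕 ⊆ F the identity K(𝓕) = 2π·χ(𝓕) + 2·excess(𝓕) − Σ_{e ∈ E′(𝓕)} n_𝓕(e)·δ′(e) holds. -/
open Finset Real

/-- The set `V(𝓕)` of vertices of faces of `𝓕`. -/
def vertsOfFaces {F C V : Type} [Fintype C] [DecidableEq F] [DecidableEq V]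
    (f : C → F) (vt : C → V) (𝓕 : Finset F) : Finset V :=
  (Finset.univ.filter (fun c => f c ∈ 𝓕)).image vt

/-- The endpoints of an edge of a face of `𝓕` are vertices of faces of `𝓕`. -/
theorem ends_subset_vertsOfFaces {F E C V : Type} [Fintype E] [Fintype C]
    [DecidableEq F] [DecidableEq E] [DecidableEq V]
    {f : C → F} {o : C → E} {vt : C → V} {ends : E → Finset V}
    (hcompat : ∀ t : F, ∃ c₁ c₂ c₃ : C, c₁ ≠ c₂ ∧ c₁ ≠ c₃ ∧ c₂ ≠ c₃ ∧
        (∀ c : C, f c = t ↔ (c = c₁ ∨ c = c₂ ∨ c = c₃)) ∧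
        ends (o c₁) = {vt c₂, vt c₃} ∧ ends (o c₂) = {vt c₁, vt c₃} ∧
        ends (o c₃) = {vt c₁, vt c₂})
    {𝓕 : Finset F} {e : E} (he : e ∈ edgesOfFaces f o 𝓕) :
    ends e ⊆ vertsOfFaces f vt 𝓕 := by
  obtain ⟨c, hc, rfl⟩ : ∃ c, f c ∈ 𝓕 ∧ o c = e := by simpa [edgesOfFaces] using he
  obtain ⟨c₁, c₂, c₃, -, -, -, hcorner, h₁, h₂, h₃⟩ := hcompat (f c)
  have hvert : ∀ c', c' = c₁ ∨ c' = c₂ ∨ c' = c₃ → vt c' ∈ vertsOfFaces f vt 𝓕 :=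
    fun c' h => mem_image_of_mem vt (by simpa [(hcorner c').2 h] using hc)
  have hv₁ := hvert c₁ (by simp)
  have hv₂ := hvert c₂ (by simp)
  have hv₃ := hvert c₃ (by simp)
  rcases (hcorner c).1 rfl with rfl | rfl | rfl <;>
    simp [h₁, h₂, h₃, insert_subset_iff, hv₁, hv₂, hv₃]

/-- Double counting of the incidences between edges and the vertices in `S`. -/
theorem sum_sum_incident_eq_sum_card_mul {E V : Type} [Fintype E] [DecidableEq V]
    (ends : E → Finset V) (S : Finset V) (g : E → ℝ) :
    ∑ w ∈ S, ∑ e ∈ univ.filter (fun e => w ∈ ends e), g e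
      = ∑ e, (((ends e).filter (fun w => w ∈ S)).card : ℝ) * g e := by
  rw [sum_comm' (t' := univ) (s' := fun e => (ends e).filter (fun w => w ∈ S))
    (by simp [and_comm])]
  simp only [sum_const, nsmul_eq_mul]

/-- **Equation (4.4).** For triangulation data with vertices (each edge with two distinct
endpoints) and any `Δ : E → ℝ`, with `δ′(e) = π − Δ(e)`, curvature
`κ_w = 2π − Σ_{e ∋ w} δ′(e)`, `K(𝓕) = Σ_{w ∈ V(𝓕)} κ_w`,
`χ(𝓕) = |V(𝓕)| − |E(𝓕)| + |𝓕|`, `E′(𝓕)` the edges outside `E(𝓕)` with an endpoint in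
`V(𝓕)` and `n_𝓕(e)` the number of endpoints of `e` in `V(𝓕)`:
`K(𝓕) = 2π·χ(𝓕) + 2·excess(𝓕) − Σ_{e ∈ E′(𝓕)} n_𝓕(e)·δ′(e)`. -/
theorem curvature_identity
    (F E C V : Type) [Fintype F] [Fintype E] [Fintype C] [Fintype V]
    [DecidableEq F] [DecidableEq E] [DecidableEq C] [DecidableEq V]
    (f : C → F) (o : C → E) (vt : C → V) (ends : E → Finset V)
    (hface : ∀ t : F, (Finset.univ.filter (fun c => f c = t)).card = 3)
    (hedge : ∀ e : E, (Finset.univ.filter (fun c => o c = e)).card = 1 ∨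
                      (Finset.univ.filter (fun c => o c = e)).card = 2)
    (hends : ∀ e : E, (ends e).card = 2)
    (hcompat : ∀ t : F, ∃ c₁ c₂ c₃ : C, c₁ ≠ c₂ ∧ c₁ ≠ c₃ ∧ c₂ ≠ c₃ ∧
        (∀ c : C, f c = t ↔ (c = c₁ ∨ c = c₂ ∨ c = c₃)) ∧
        ends (o c₁) = {vt c₂, vt c₃} ∧ ends (o c₂) = {vt c₁, vt c₃} ∧
        ends (o c₃) = {vt c₁, vt c₂})
    (Δ : E → ℝ) (𝓕 : Finset F) :
    -- K(𝓕)
    (∑ w ∈ vertsOfFaces f vt 𝓕,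
        (2 * π - ∑ e ∈ Finset.univ.filter (fun e => w ∈ ends e), (π - Δ e)))
    = 2 * π * (((vertsOfFaces f vt 𝓕).card : ℝ)
               - ((edgesOfFaces f o 𝓕).card : ℝ) + (𝓕.card : ℝ))
      + 2 * excess f o Δ 𝓕
      - ∑ e ∈ Finset.univ.filter (fun e => e ∉ edgesOfFaces f o 𝓕 ∧
            ∃ w ∈ ends e, w ∈ vertsOfFaces f vt 𝓕),
          (((ends e).filter (fun w => w ∈ vertsOfFaces f vt 𝓕)).card : ℝ) * (π - Δ e) := by
  set S := vertsOfFaces f vt 𝓕 with hS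
  set T := edgesOfFaces f o 𝓕 with hT
  have hfull : ∀ e ∈ T, (ends e).filter (fun w => w ∈ S) = ends e := fun e he =>
    filter_true_of_mem (ends_subset_vertsOfFaces hcompat he)
  have hcone : ∑ w ∈ S, ∑ e ∈ univ.filter (fun e => w ∈ ends e), (π - Δ e)
      = ∑ e, (((ends e).filter (fun w => w ∈ S)).card : ℝ) * (π - Δ e) :=
    sum_sum_incident_eq_sum_card_mul ends S fun e => π - Δ e
  have hinner : ∑ e ∈ univ.filter (fun e => e ∈ T),
      (((ends e).filter (fun w => w ∈ S)).card : ℝ) * (π - Δ e)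
      = 2 * π * (T.card : ℝ) - 2 * ∑ e ∈ T, Δ e := by
    have hterm : ∀ e ∈ T, (((ends e).filter (fun w => w ∈ S)).card : ℝ) * (π - Δ e)
        = 2 * (π - Δ e) := fun e he => by rw [hfull e he, hends e, Nat.cast_ofNat]
    rw [filter_univ_mem, sum_congr rfl hterm, ← mul_sum, sum_sub_distrib, sum_const,
      nsmul_eq_mul]
    ring
  have houter : ∑ e ∈ univ.filter (fun e => e ∉ T ∧ ∃ w ∈ ends e, w ∈ S),
      (((ends e).filter (fun w => w ∈ S)).card : ℝ) * (π - Δ e)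
      = ∑ e ∈ univ.filter (fun e => e ∉ T),
        (((ends e).filter (fun w => w ∈ S)).card : ℝ) * (π - Δ e) := by
    rw [← filter_filter]
    refine sum_filter_of_ne fun e _ hne => ?_
    by_contra hno
    push Not at hno
    exact hne (by rw [filter_false_of_mem hno, card_empty, Nat.cast_zero, zero_mul])
  rw [sum_sub_distrib, sum_const, nsmul_eq_mul, hcone, houter,
    ← sum_filter_add_sum_filter_not univ (fun e => e ∈ T), hinner, excess, ← hT]
  ring
end

section
/- Let P ⊂ ℝ² be a finite set, not all collinear, and let D be a Delaunay triangulation of P. Then: (i) for every interior vertex p ∈ P, Σ_{e : p ∈ e} (π − δ(e)) = 2π; (ii) for every boundary vertex p ∈ P, writing Λ(p) for the boundary angle at p (the sum of the angles at p of the triangles of D containing p), Σ_{e : p ∈ e} (π − δ(e)) + (π − Λ(p)) = 2π; (iii) Σ over all edges of δ(e) equals π·|D|; and (iv) for every nonempty proper subset S ⊊ D of triangles, excess(S) > 0. (These are the necessity assertions underlying Theorem 5.1: every planar Delaunay triangulation satisfies Conditions 2.1 and 2.2 and the vertex angle conditions.) -/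
noncomputable section
open Finset Real EuclideanGeometry

attribute [local instance] Classical.propDecidable

/-- The Euclidean plane. -/
abbrev Pt := EuclideanSpace ℝ (Fin 2)

/-- The (unsigned) angle at `p` subtended by the two endpoints of a two-element set `e`:
for `e = {a, b}` with `a ≠ b` this is `∠ a p b`. -/
def oppAngle (p : Pt) (e : Finset Pt) : ℝ :=
  (1 / 2) * ∑ a ∈ e, ∑ b ∈ e.erase a, EuclideanGeometry.angle a p b

/-- The set of edges (2-element subsets of triangles) of a set of triangles. -/
def edgesOf (D : Finset (Finset Pt)) : Finset (Finset Pt) :=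
  D.biUnion (fun t => Finset.powersetCard 2 t)

/-- The dihedral angle of an edge `e`: the sum, over the triangles of `D` containing `e`,
of the angle of the triangle at its vertex opposite to `e`. -/
def dihedral (D : Finset (Finset Pt)) (e : Finset Pt) : ℝ :=
  ∑ t ∈ D.filter (fun t => e ⊆ t), ∑ p ∈ t \ e, oppAngle p e

/-- The boundary angle at a vertex `p`: the sum of the angles at `p` of the triangles of
`D` containing `p`. -/
def bdryAngle (D : Finset (Finset Pt)) (p : Pt) : ℝ :=
  ∑ t ∈ D.filter (fun t => p ∈ t), oppAngle p (t.erase p)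

/-- `D` is a triangulation of the convex hull of `P` with vertex set `P`: a finite set of
3-element affinely independent subsets of `P` whose closed triangles cover `conv(P)`,
any two distinct triangles meeting in a common edge, a common vertex, or not at all,
and every point of `P` a vertex of some triangle. -/
structure IsTriangulationOf (D : Finset (Finset Pt)) (P : Finset Pt) : Prop where
  card3 : ∀ t ∈ D, t.card = 3
  subset : ∀ t ∈ D, t ⊆ P
  indep : ∀ t ∈ D, AffineIndependent ℝ (fun p : (t : Finset Pt) => (p : Pt))
  cover : (⋃ t ∈ D, convexHull ℝ (t : Set Pt)) = convexHull ℝ (P : Set Pt)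
  inter : ∀ t ∈ D, ∀ t' ∈ D, t ≠ t' →
    convexHull ℝ (t : Set Pt) ∩ convexHull ℝ (t' : Set Pt)
      = convexHull ℝ ((t ∩ t' : Finset Pt) : Set Pt)
  vertex : ∀ p ∈ P, ∃ t ∈ D, p ∈ t

/-- The empty-circumdisk condition: for every triangle `t ∈ D`, the open circumscribed
disk of `t` contains no point of `P` (stated via circumcenters: any point equidistant
from the vertices of `t` at distance `r` is at distance at least `r` from every point
of `P`). -/
def EmptyCircumdisk (D : Finset (Finset Pt)) (P : Finset Pt) : Prop :=
  ∀ t ∈ D, ∀ z : Pt, ∀ r : ℝ, (∀ q ∈ t, dist z q = r) → ∀ p ∈ P, r ≤ dist z p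

/-- `D` is a Delaunay triangulation of `P`. -/
def IsDelaunay (D : Finset (Finset Pt)) (P : Finset Pt) : Prop :=
  IsTriangulationOf D P ∧ EmptyCircumdisk D P


/-- The planar cross product (determinant) of two vectors. -/
def wedge (u v : Pt) : ℝ := u 0 * v 1 - u 1 * v 0

lemma wedge_swap (u v : Pt) : wedge u v = -wedge v u := by
  simp only [wedge]; ring

lemma wedge_self_zero (u : Pt) : wedge u u = 0 := by
  simp only [wedge]; ring

lemma wedge_add_right (u v w : Pt) : wedge u (v + w) = wedge u v + wedge u w := by
  simp only [wedge, PiLp.add_apply]; ring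

lemma wedge_smul_right (u v : Pt) (r : ℝ) : wedge u (r • v) = r * wedge u v := by
  simp only [wedge, PiLp.smul_apply, smul_eq_mul]; ring

lemma wedge_smul_left (u v : Pt) (r : ℝ) : wedge (r • u) v = r * wedge u v := by
  simp only [wedge, PiLp.smul_apply, smul_eq_mul]; ring

lemma sq_add_sq_pos_of_ne_zero {u : Pt} (hu : u ≠ 0) : 0 < u 0 ^ 2 + u 1 ^ 2 := by
  by_contra! hle
  apply hu
  ext i
  have e0 : u 0 = 0 := by nlinarith [sq_nonneg (u 0), sq_nonneg (u 1)]
  have e1 : u 1 = 0 := by nlinarith [sq_nonneg (u 0), sq_nonneg (u 1)]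
  fin_cases i
  · simpa using e0
  · simpa using e1

lemma exists_smul_of_wedge_eq_zero {u v : Pt} (hu : u ≠ 0) (h : wedge u v = 0) :
    ∃ r : ℝ, v = r • u := by
  have hu' : u 0 ≠ 0 ∨ u 1 ≠ 0 := by
    by_contra! h0
    exact hu (by ext i; fin_cases i <;> simp [h0])
  simp only [wedge] at h
  rcases hu' with h0 | h1
  · refine ⟨v 0 / u 0, ?_⟩
    ext i
    simp only [PiLp.smul_apply, smul_eq_mul]
    field_simp
    fin_cases i <;> simp
    linarith
  · refine ⟨v 1 / u 1, ?_⟩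
    ext i
    simp only [PiLp.smul_apply, smul_eq_mul]
    field_simp
    fin_cases i <;> simp
    linarith

/-- Cramer's rule in the plane. -/
lemma eq_smul_add_smul_of_wedge_ne_zero {u w : Pt} (h : wedge u w ≠ 0) (v : Pt) :
    v = (wedge v w / wedge u w) • u + (wedge u v / wedge u w) • w := by
  ext i
  simp only [PiLp.add_apply, PiLp.smul_apply, smul_eq_mul]
  field_simp
  fin_cases i <;> simp [wedge] <;> ring

lemma collinear_of_wedge_eq_zero {s : Set Pt} {p a : Pt} (hp : p ∈ s) (hap : a ≠ p)
    (h : ∀ q ∈ s, wedge (a - p) (q - p) = 0) : Collinear ℝ s := by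
  rw [collinear_iff_of_mem hp]
  refine ⟨a - p, fun q hq => ?_⟩
  obtain ⟨r, hr⟩ := exists_smul_of_wedge_eq_zero (sub_ne_zero.mpr hap) (h q hq)
  exact ⟨r, by rw [vadd_eq_add, ← hr]; abel⟩

lemma mem_convexHull_triple {p a b x : Pt} :
    x ∈ convexHull ℝ ({p, a, b} : Set Pt) ↔
      ∃ β γ : ℝ, 0 ≤ β ∧ 0 ≤ γ ∧ β + γ ≤ 1 ∧ x - p = β • (a - p) + γ • (b - p) := by
  constructor
  · intro hx
    rw [convexHull_insert (Set.insert_nonempty _ _), convexHull_pair, mem_convexJoin] at hx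
    obtain ⟨p', hp', y, ⟨c, d, hc, hd, hcd, rfl⟩, ⟨e, f, he, hf, hef, rfl⟩⟩ := hx
    obtain rfl : p' = p := hp'
    refine ⟨f * c, f * d, by positivity, by positivity, by rw [← mul_add, hcd]; linarith, ?_⟩
    obtain rfl : d = 1 - c := by linarith
    obtain rfl : e = 1 - f := by linarith
    module
  · rintro ⟨β, γ, hβ, hγ, h1, hx⟩
    have hx' : x = (1 - β - γ) • p + β • a + γ • b := by
      rw [← sub_add_cancel x p, hx]; module
    rw [hx']
    have hc := convex_convexHull ℝ ({p, a, b} : Set Pt)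
    have hs := subset_convexHull ℝ ({p, a, b} : Set Pt)
    have := hc.sum_mem (t := Finset.univ) (w := ![1 - β - γ, β, γ]) (z := ![p, a, b])
      (by intro i _; fin_cases i <;> (simp; linarith))
      (by simp [Fin.sum_univ_three]; ring) (by intro i _; apply hs; fin_cases i <;> simp)
    simpa [Fin.sum_univ_three] using this

lemma not_collinear_of_affineIndependent {p a b : Pt} (hcard : ({p, a, b} : Finset Pt).card = 3)
    (h : AffineIndependent ℝ (fun q : ({p, a, b} : Finset Pt) => (q : Pt))) :
    ¬ Collinear ℝ ({p, a, b} : Set Pt) := by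
  rw [← affineIndependent_iff_not_collinear_set]
  obtain ⟨hpa, hpb, hab⟩ := Finset.card_triple_eq_three_iff.mp hcard
  let f : Fin 3 → ({p, a, b} : Finset Pt) :=
    ![⟨p, by simp⟩, ⟨a, by simp⟩, ⟨b, by simp⟩]
  have hf : Function.Injective f := by
    intro i j hij
    fin_cases i <;> fin_cases j <;> simp_all [f]
  convert! h.comp_embedding ⟨f, hf⟩ using 1
  funext i
  fin_cases i <;> rfl

lemma wedge_ne_zero_of_not_collinear {p a b : Pt} (h : ¬ Collinear ℝ ({p, a, b} : Set Pt)) :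
    wedge (a - p) (b - p) ≠ 0 := by
  intro h0
  refine h (collinear_of_wedge_eq_zero (p := p) (a := a) (by simp)
    (fun hap => h (by simpa [hap] using collinear_pair ℝ p b)) ?_)
  rintro q (rfl | rfl | rfl)
  · simp [wedge]
  · exact wedge_self_zero _
  · exact h0

lemma mem_of_openSegment_mem_convexHull_subset {t u : Finset Pt} {p a x : Pt}
    (ht : AffineIndependent ℝ (fun q : t => (q : Pt))) (hu : u ⊆ t) (hp : p ∈ t) (ha : a ∈ t)
    (hpa : p ≠ a) (hx : x ∈ openSegment ℝ p a) (h : x ∈ convexHull ℝ (u : Set Pt)) : a ∈ u := by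
  by_contra hau
  have := ht.convexHull_inter (R := ℝ) (t₁ := {p, a}) (t₂ := u)
    (Finset.insert_subset hp (Finset.singleton_subset_iff.mpr ha)) hu
  have hm : x ∈ convexHull ℝ ((({p, a} : Finset Pt) : Set Pt) ∩ u) := by
    rw [this]
    refine ⟨?_, h⟩
    rw [Finset.coe_pair, convexHull_pair]
    exact openSegment_subset_segment ℝ _ _ hx
  have hsub : ((({p, a} : Finset Pt) : Set Pt) ∩ u) ⊆ {p} := by
    rintro q ⟨hq, hqu⟩
    simp only [Finset.coe_pair, Set.mem_insert_iff, Set.mem_singleton_iff] at hq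
    rcases hq with rfl | rfl
    · rfl
    · exact absurd hqu hau
  have hxp : x = p := by simpa using convexHull_mono hsub hm
  subst hxp
  exact hpa (left_mem_openSegment_iff.mp hx)

namespace IsTriangulationOf

variable {D : Finset (Finset Pt)} {P : Finset Pt}

lemma mem_convexHull_inter (hT : IsTriangulationOf D P) {t t' : Finset Pt} (ht : t ∈ D)
    (ht' : t' ∈ D) {x : Pt} (hx : x ∈ convexHull ℝ (t : Set Pt))
    (hx' : x ∈ convexHull ℝ (t' : Set Pt)) : x ∈ convexHull ℝ ((t ∩ t' : Finset Pt) : Set Pt) := by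
  by_cases h : t = t'
  · subst h; rwa [Finset.inter_self]
  · rw [← hT.inter t ht t' ht' h]; exact ⟨hx, hx'⟩

/-- A triangle meeting the relative interior of an edge contains both endpoints of that edge. -/
lemma edge_subset (hT : IsTriangulationOf D P) {t t' : Finset Pt} (ht : t ∈ D)
    (ht' : t' ∈ D) {p a x : Pt} (hp : p ∈ t) (ha : a ∈ t) (hpa : p ≠ a)
    (hx : x ∈ openSegment ℝ p a) (hx' : x ∈ convexHull ℝ (t' : Set Pt)) : p ∈ t' ∧ a ∈ t' := by
  have hxt : x ∈ convexHull ℝ (t : Set Pt) :=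
    (convex_convexHull ℝ _).segment_subset (subset_convexHull ℝ _ hp) (subset_convexHull ℝ _ ha)
      (openSegment_subset_segment ℝ _ _ hx)
  have h := hT.mem_convexHull_inter ht ht' hxt hx'
  constructor
  · rw [openSegment_symm] at hx
    exact (Finset.mem_inter.mp (mem_of_openSegment_mem_convexHull_subset (hT.indep t ht)
      Finset.inter_subset_left ha hp hpa.symm hx h)).2
  · exact (Finset.mem_inter.mp (mem_of_openSegment_mem_convexHull_subset (hT.indep t ht)
      Finset.inter_subset_left hp ha hpa hx h)).2

lemma not_collinear (hT : IsTriangulationOf D P) {p a b : Pt} (h : {p, a, b} ∈ D) :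
    ¬ Collinear ℝ ({p, a, b} : Set Pt) :=
  not_collinear_of_affineIndependent (hT.card3 _ h) (hT.indep _ h)

lemma wedge_ne_zero (hT : IsTriangulationOf D P) {p a b : Pt} (h : {p, a, b} ∈ D) :
    wedge (a - p) (b - p) ≠ 0 :=
  wedge_ne_zero_of_not_collinear (hT.not_collinear h)

lemma exists_third (hT : IsTriangulationOf D P) {t : Finset Pt} (ht : t ∈ D) {p a : Pt}
    (hp : p ∈ t) (ha : a ∈ t) (hpa : p ≠ a) : ∃ b, t = {p, a, b} := by
  have h1 : ((t.erase p).erase a).card = 1 := by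
    rw [Finset.card_erase_of_mem (Finset.mem_erase.mpr ⟨hpa.symm, ha⟩),
      Finset.card_erase_of_mem hp, hT.card3 t ht]
  obtain ⟨b, hb⟩ := Finset.card_eq_one.mp h1
  refine ⟨b, ?_⟩
  rw [← hb, Finset.insert_erase (Finset.mem_erase.mpr ⟨hpa.symm, ha⟩), Finset.insert_erase hp]

/-- If some point of the convex hull lies strictly on one side of an edge, then there is a triangle
on that side of the edge. -/
lemma exists_triangle_on_side (hT : IsTriangulationOf D P) {t : Finset Pt} (ht : t ∈ D) {p a q : Pt}
    (hp : p ∈ t) (ha : a ∈ t) (hpa : p ≠ a) (hq : q ∈ convexHull ℝ (P : Set Pt))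
    (h : wedge (a - p) (q - p) ≠ 0) :
    ∃ b, {p, a, b} ∈ D ∧ 0 < wedge (a - p) (b - p) * wedge (a - p) (q - p) := by
  set m : Pt := (1 / 2 : ℝ) • p + (1 / 2 : ℝ) • a with hm
  have hmo : m ∈ openSegment ℝ p a := ⟨1 / 2, 1 / 2, by norm_num, by norm_num, by norm_num, rfl⟩
  let f : ℝ → Pt := fun s => (1 - s) • m + s • q
  have hf : Continuous f := by fun_prop
  have hf0 : f 0 = m := by simp [f]
  have hmP : m ∈ convexHull ℝ (P : Set Pt) :=
    (convex_convexHull ℝ _).segment_subset (subset_convexHull ℝ _ (hT.subset t ht hp))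
      (subset_convexHull ℝ _ (hT.subset t ht ha)) (openSegment_subset_segment ℝ _ _ hmo)
  have hev : ∀ᶠ s in nhdsWithin (0 : ℝ) (Set.Ioi 0), ∀ t' ∈ D,
      f s ∈ convexHull ℝ (t' : Set Pt) → m ∈ convexHull ℝ (t' : Set Pt) := by
    rw [Filter.eventually_all_finset]
    intro t' _
    by_cases hmt : m ∈ convexHull ℝ (t' : Set Pt)
    · exact Filter.Eventually.of_forall fun _ _ => hmt
    · have hcl : IsClosed (convexHull ℝ (t' : Set Pt)) :=
        (t'.finite_toSet.isCompact_convexHull ℝ).isClosed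
      have := hf.continuousAt.eventually (hcl.isOpen_compl.mem_nhds (by rwa [hf0] : f 0 ∈ _))
      exact Filter.Eventually.mono (nhdsWithin_le_nhds this) fun s hs hs' => absurd hs' hs
  have hlt : ∀ᶠ s in nhdsWithin (0 : ℝ) (Set.Ioi 0), s < 1 :=
    nhdsWithin_le_nhds (Iio_mem_nhds one_pos)
  obtain ⟨s, ⟨hs, hs1⟩, hs0⟩ := ((hev.and hlt).and self_mem_nhdsWithin).exists
  replace hs0 : 0 < s := hs0
  have hfs : f s ∈ convexHull ℝ (P : Set Pt) :=
    convex_convexHull ℝ _ hmP hq (by linarith) hs0.le (by ring)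
  rw [← hT.cover] at hfs
  simp only [Set.mem_iUnion] at hfs
  obtain ⟨t', ht', hft'⟩ := hfs
  obtain ⟨hpt, hat⟩ := hT.edge_subset ht ht' hp ha hpa hmo (hs t' ht' hft')
  obtain ⟨b, rfl⟩ := hT.exists_third ht' hpt hat hpa
  refine ⟨b, ht', ?_⟩
  have hft'' : f s ∈ convexHull ℝ ({p, a, b} : Set Pt) := by simpa using hft'
  obtain ⟨β, γ, hβ, hγ, hβγ, hx⟩ := mem_convexHull_triple.mp hft''
  have h1 : f s - p = ((1 - s) / 2) • (a - p) + s • (q - p) := by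
    simp only [f, hm]; module
  have h2 : s * wedge (a - p) (q - p) = γ * wedge (a - p) (b - p) := by
    have := congrArg (wedge (a - p)) (h1.symm.trans hx)
    simpa [wedge_add_right, wedge_smul_right, wedge_self_zero] using this
  have h3 : 0 < γ * (wedge (a - p) (b - p) * wedge (a - p) (q - p)) := by
    rw [← mul_assoc, ← h2, mul_assoc]
    exact mul_pos hs0 (mul_self_pos.mpr h)
  exact pos_of_mul_pos_right h3 hγ

/-- There is at most one triangle on each side of an edge. -/
lemma triangle_on_side_unique (hT : IsTriangulationOf D P) {p a b c : Pt} (hb : {p, a, b} ∈ D)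
    (hc : {p, a, c} ∈ D) (h : 0 < wedge (a - p) (b - p) * wedge (a - p) (c - p)) : b = c := by
  by_contra hbc
  have hc0 := hT.wedge_ne_zero hc
  have hb0 := hT.wedge_ne_zero hb
  set l := wedge (b - p) (c - p) / wedge (a - p) (c - p) with hl
  set μ := wedge (a - p) (b - p) / wedge (a - p) (c - p) with hμ
  have hμ0 : 0 < μ := div_pos_iff.mpr (pos_and_pos_or_neg_and_neg_of_mul_pos h)
  have hbl : b - p = l • (a - p) + μ • (c - p) := eq_smul_add_smul_of_wedge_ne_zero hc0 _
  set ε := 1 / (2 * (1 + |l| + μ)) with hε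
  have hden : 0 < 1 + |l| + μ := by positivity
  have hε0 : 0 < ε := by positivity
  have hεeq : ε * 1 + ε * |l| + ε * μ = 1 / 2 := by rw [hε]; field_simp
  have hεl : 0 ≤ ε * |l| := by positivity
  have hεμ : 0 ≤ ε * μ := by positivity
  have hl1 : ε * l ≤ ε * |l| := by gcongr; exact le_abs_self l
  have hl2 : -(ε * |l|) ≤ ε * l := by rw [← mul_neg]; gcongr; exact neg_abs_le l
  set x : Pt := p + ((1 - ε) / 2) • (a - p) + ε • (b - p) with hx
  have hxb : x ∈ convexHull ℝ (({p, a, b} : Finset Pt) : Set Pt) := by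
    push_cast
    exact mem_convexHull_triple.mpr ⟨(1 - ε) / 2, ε, by linarith, by linarith, by linarith,
      by rw [hx]; abel⟩
  have hxc : x ∈ convexHull ℝ (({p, a, c} : Finset Pt) : Set Pt) := by
    push_cast
    exact mem_convexHull_triple.mpr ⟨(1 - ε) / 2 + ε * l, ε * μ, by linarith, by linarith,
      by linarith, by rw [hx, hbl]; module⟩
  have hxi := hT.mem_convexHull_inter hb hc hxb hxc
  obtain ⟨-, hpb, hab⟩ := Finset.card_triple_eq_three_iff.mp (hT.card3 _ hb)
  have hsub : (({p, a, b} ∩ {p, a, c} : Finset Pt) : Set Pt) ⊆ {p, a, a} := by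
    intro y hy
    simp only [Finset.coe_inter, Set.mem_inter_iff, Finset.mem_coe, Finset.mem_insert,
      Finset.mem_singleton] at hy
    simp only [Set.mem_insert_iff, Set.mem_singleton_iff]
    rcases hy with ⟨rfl | rfl | rfl, h2⟩
    · simp
    · simp
    · rcases h2 with h2 | h2 | h2
      · exact absurd h2.symm hpb
      · exact absurd h2.symm hab
      · exact absurd h2 hbc
  obtain ⟨β, γ, -, -, -, hx'⟩ := mem_convexHull_triple.mp (convexHull_mono hsub hxi)
  have h1 : x - p = ((1 - ε) / 2) • (a - p) + ε • (b - p) := by rw [hx]; abel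
  have := congrArg (wedge (a - p)) (h1.symm.trans hx')
  simp only [wedge_add_right, wedge_smul_right, wedge_self_zero, mul_zero, zero_add,
    mul_eq_zero, add_zero] at this
  exact this.elim hε0.ne' hb0

/-- Distinct edges at a vertex point in distinct directions. -/
lemma neighbor_eq_of_smul (hT : IsTriangulationOf D P) {t t' : Finset Pt} (ht : t ∈ D)
    (ht' : t' ∈ D) {p a b : Pt} (hp : p ∈ t) (ha : a ∈ t) (hp' : p ∈ t') (hb : b ∈ t')
    (hpa : p ≠ a) (hpb : p ≠ b) {r : ℝ} (hr : 0 < r) (h : b - p = r • (a - p)) : a = b := by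
  have key : ∀ {t t' : Finset Pt} {a b : Pt} {r : ℝ}, t ∈ D → t' ∈ D → p ∈ t → a ∈ t → p ∈ t' →
      b ∈ t' → p ≠ a → p ≠ b → 0 < r → r ≤ 1 → b - p = r • (a - p) → a = b := by
    intro t t' a b r ht ht' hp ha hp' hb hpa hpb hr hr1 h
    by_contra hab
    have hr1' : r < 1 := by
      refine lt_of_le_of_ne hr1 ?_
      rintro rfl
      rw [one_smul, sub_left_inj] at h
      exact hab h.symm
    have hbo : b ∈ openSegment ℝ p a := by
      refine ⟨1 - r, r, by linarith, hr, by ring, ?_⟩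
      rw [← sub_add_cancel b p, h]; module
    have hat := (hT.edge_subset ht ht' hp ha hpa hbo (subset_convexHull ℝ _ hb)).2
    obtain ⟨c, rfl⟩ := hT.exists_third ht' hp' hat hpa
    have hbc : b = c := by
      simp only [Finset.mem_insert, Finset.mem_singleton] at hb
      rcases hb with rfl | rfl | rfl
      · exact absurd rfl hpb
      · exact absurd rfl hab
      · rfl
    subst hbc
    apply hT.wedge_ne_zero ht'
    rw [h, wedge_smul_right, wedge_self_zero, mul_zero]
  rcases le_total r 1 with h1 | h1
  · exact key ht ht' hp ha hp' hb hpa hpb hr h1 h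
  · refine (key ht' ht hp' hb hp ha hpb hpa (inv_pos.mpr hr) (inv_le_one_of_one_le₀ h1) ?_).symm
    rw [h, smul_smul, inv_mul_cancel₀ hr.ne', one_smul]

end IsTriangulationOf

lemma oppAngle_pair (p : Pt) {a b : Pt} (hab : a ≠ b) :
    oppAngle p {a, b} = EuclideanGeometry.angle a p b := by
  have h1 : ({a, b} : Finset Pt).erase a = {b} := by
    rw [Finset.erase_insert]; simpa using hab
  have h2 : ({a, b} : Finset Pt).erase b = {a} := by
    rw [Finset.pair_comm, Finset.erase_insert]; simpa using hab.symm
  rw [oppAngle, Finset.sum_pair hab, h1, h2, Finset.sum_singleton, Finset.sum_singleton,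
    EuclideanGeometry.angle_comm b p a]
  ring

lemma oppAngle_erase_triple {p a b : Pt} (h : ({p, a, b} : Finset Pt).card = 3) :
    oppAngle p (({p, a, b} : Finset Pt).erase p) = EuclideanGeometry.angle a p b := by
  obtain ⟨hpa, hpb, hab⟩ := Finset.card_triple_eq_three_iff.mp h
  rw [Finset.erase_insert (by simp [hpa, hpb]), oppAngle_pair p hab]

lemma exists_eq_triple_of_mem {t : Finset Pt} (h : t.card = 3) {p : Pt} (hp : p ∈ t) :
    ∃ a b, t = {p, a, b} := by
  have h2 : (t.erase p).card = 2 := by rw [Finset.card_erase_of_mem hp, h]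
  obtain ⟨a, b, -, hab⟩ := Finset.card_eq_two.mp h2
  exact ⟨a, b, by rw [← hab, Finset.insert_erase hp]⟩

lemma sum_oppAngle_erase {t : Finset Pt} (h : t.card = 3) :
    ∑ q ∈ t, oppAngle q (t.erase q) = π := by
  obtain ⟨p, a, b, hpa, hpb, hab, rfl⟩ := Finset.card_eq_three.mp h
  have h1 : ({p, a, b} : Finset Pt) = {a, b, p} := by ext; simp; tauto
  have h2 : ({p, a, b} : Finset Pt) = {b, p, a} := by ext; simp; tauto
  rw [Finset.sum_insert (by simp [hpa, hpb]), Finset.sum_pair hab, oppAngle_erase_triple h]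
  nth_rw 1 [h1]
  nth_rw 1 [h2]
  rw [oppAngle_erase_triple (h1 ▸ h), oppAngle_erase_triple (h2 ▸ h)]
  linarith [EuclideanGeometry.angle_add_angle_add_angle_eq_pi b hpa]

lemma oppAngle_erase_pos {t : Finset Pt} (h : t.card = 3)
    (ht : AffineIndependent ℝ (fun q : t => (q : Pt))) {p : Pt} (hp : p ∈ t) :
    0 < oppAngle p (t.erase p) := by
  obtain ⟨a, b, rfl⟩ := exists_eq_triple_of_mem h hp
  rw [oppAngle_erase_triple h]
  have := not_collinear_of_affineIndependent h ht
  rw [Set.insert_comm] at this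
  exact EuclideanGeometry.angle_pos_of_not_collinear this

lemma powersetCard_two_eq_image_erase {t : Finset Pt} (h : t.card = 3) :
    Finset.powersetCard 2 t = t.image t.erase := by
  ext e
  simp only [Finset.mem_powersetCard, Finset.mem_image]
  constructor
  · rintro ⟨he, hc⟩
    have h1 : (t \ e).card = 1 := by rw [Finset.card_sdiff_of_subset he, h, hc]
    obtain ⟨q, hq⟩ := Finset.card_eq_one.mp h1
    refine ⟨q, (Finset.mem_sdiff.mp (hq ▸ Finset.mem_singleton_self q)).1, ?_⟩
    rw [← Finset.sdiff_singleton_eq_erase, ← hq, Finset.sdiff_sdiff_eq_self he]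
  · rintro ⟨q, hq, rfl⟩
    exact ⟨Finset.erase_subset _ _, by rw [Finset.card_erase_of_mem hq, h]⟩

lemma sdiff_erase_of_mem {t : Finset Pt} {q : Pt} (hq : q ∈ t) : t \ t.erase q = {q} := by
  rw [← Finset.sdiff_singleton_eq_erase,
    Finset.sdiff_sdiff_eq_self (Finset.singleton_subset_iff.mpr hq)]

/-- Double counting of the triangle angles: summing dihedral angles over the edges with a property
is summing, over all triangles, the angles opposite to the edges with that property. -/
lemma sum_dihedral_filter {D : Finset (Finset Pt)} (h3 : ∀ t ∈ D, t.card = 3)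
    (Q : Finset Pt → Prop) [DecidablePred Q] :
    ∑ e ∈ (edgesOf D).filter Q, dihedral D e
      = ∑ t ∈ D, ∑ q ∈ t.filter (fun q => Q (t.erase q)), oppAngle q (t.erase q) := by
  simp only [dihedral]
  rw [Finset.sum_comm' (t' := D) (s' := fun t => (Finset.powersetCard 2 t).filter Q)]
  · refine Finset.sum_congr rfl fun t ht => ?_
    rw [powersetCard_two_eq_image_erase (h3 t ht), Finset.filter_image, Finset.sum_image]
    · refine Finset.sum_congr rfl fun q hq => ?_
      rw [sdiff_erase_of_mem (Finset.mem_filter.mp hq).1, Finset.sum_singleton]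
    · exact (Finset.erase_injOn t).mono fun q hq => (Finset.mem_filter.mp hq).1
  · intro e t
    simp only [Finset.mem_filter, edgesOf, Finset.mem_biUnion, Finset.mem_powersetCard]
    constructor
    · rintro ⟨⟨⟨s, hs, hes, hc⟩, hQ⟩, ht, het⟩
      exact ⟨⟨⟨het, hc⟩, hQ⟩, ht⟩
    · rintro ⟨⟨⟨het, hc⟩, hQ⟩, ht⟩
      exact ⟨⟨⟨t, ht, het, hc⟩, hQ⟩, ht, het⟩

lemma sum_dihedral {D : Finset (Finset Pt)} (h3 : ∀ t ∈ D, t.card = 3) :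
    ∑ e ∈ edgesOf D, dihedral D e = π * D.card := by
  have h := sum_dihedral_filter h3 (fun _ => True)
  simp only [Finset.filter_true] at h
  rw [h, Finset.sum_congr rfl fun t ht => sum_oppAngle_erase (h3 t ht), Finset.sum_const,
    nsmul_eq_mul, mul_comm]

lemma sum_dihedral_at_vertex {D : Finset (Finset Pt)} (h3 : ∀ t ∈ D, t.card = 3) (p : Pt) :
    ∑ e ∈ (edgesOf D).filter (fun e => p ∈ e), dihedral D e
      = π * (D.filter (fun t => p ∈ t)).card - bdryAngle D p := by
  rw [sum_dihedral_filter h3, bdryAngle, mul_comm, ← nsmul_eq_mul, ← Finset.sum_const,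
    ← Finset.sum_sub_distrib, Finset.sum_filter]
  refine Finset.sum_congr rfl fun t ht => ?_
  split_ifs with hp
  · rw [← sum_oppAngle_erase (h3 t ht), ← Finset.add_sum_erase t _ hp, add_sub_cancel_left]
    refine Finset.sum_congr ?_ fun _ _ => rfl
    ext q
    simp only [Finset.mem_filter, Finset.mem_erase]
    tauto
  · refine Finset.sum_eq_zero fun q hq => ?_
    exact absurd (Finset.mem_of_mem_erase (Finset.mem_filter.mp hq).2) hp

lemma sum_oppAngle_sdiff_pos {t e : Finset Pt} (h : t.card = 3)
    (ht : AffineIndependent ℝ (fun q : t => (q : Pt))) (he : e ∈ Finset.powersetCard 2 t) :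
    0 < ∑ p ∈ t \ e, oppAngle p e := by
  rw [powersetCard_two_eq_image_erase h, Finset.mem_image] at he
  obtain ⟨q, hq, rfl⟩ := he
  rw [sdiff_erase_of_mem hq, Finset.sum_singleton]
  exact oppAngle_erase_pos h ht hq

/-- A set of triangles has positive excess as soon as one of its edges is shared with a triangle
outside the set. -/
lemma excess_pos_of_shared_edge {D S : Finset (Finset Pt)} (h3 : ∀ t ∈ D, t.card = 3)
    (hind : ∀ t ∈ D, AffineIndependent ℝ (fun q : t => (q : Pt))) (hSD : S ⊆ D)
    {t : Finset Pt} (ht : t ∈ D) (htS : t ∉ S) {e : Finset Pt} (he : e ∈ edgesOf S) (het : e ⊆ t) :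
    0 < (∑ e ∈ edgesOf S, dihedral D e) - π * S.card := by
  rw [← sum_dihedral fun t ht => h3 t (hSD ht), sub_pos]
  have hcard : ∀ e ∈ edgesOf S, e.card = 2 := by
    intro e he
    obtain ⟨s, -, hes⟩ := Finset.mem_biUnion.mp he
    exact (Finset.mem_powersetCard.mp hes).2
  have hpos : ∀ e ∈ edgesOf S, ∀ s ∈ D.filter (fun t => e ⊆ t), 0 < ∑ p ∈ s \ e, oppAngle p e := by
    intro e he s hs
    obtain ⟨hs, hes⟩ := Finset.mem_filter.mp hs
    exact sum_oppAngle_sdiff_pos (h3 s hs) (hind s hs)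
      (Finset.mem_powersetCard.mpr ⟨hes, hcard e he⟩)
  refine Finset.sum_lt_sum (fun e he => ?_) ⟨e, he, ?_⟩
  · exact Finset.sum_le_sum_of_subset_of_nonneg (Finset.filter_subset_filter _ hSD)
      fun s hs _ => (hpos e he s hs).le
  · have htm : t ∈ D.filter (fun t => e ⊆ t) := Finset.mem_filter.mpr ⟨ht, het⟩
    exact Finset.sum_lt_sum_of_subset (Finset.filter_subset_filter _ hSD) htm
      (fun h => htS (Finset.mem_filter.mp h).1) (hpos e he t htm) fun s hs _ => (hpos e he s hs).le

/-- A triangle is not covered by finitely many lines through a point. -/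
lemma exists_mem_convexHull_wedge_ne_zero {p a b x : Pt} (h : wedge (a - p) (b - p) ≠ 0)
    (Q : Finset Pt) (hx : x ∉ Q) :
    ∃ y ∈ convexHull ℝ ({p, a, b} : Set Pt), ∀ q ∈ Q, wedge (q - x) (y - x) ≠ 0 := by
  let F : Pt → Polynomial ℝ := fun q => Polynomial.C (wedge (q - x) (p - x))
    + Polynomial.C (wedge (q - x) (a - p)) * Polynomial.X
    + Polynomial.C (wedge (q - x) (b - p)) * Polynomial.X ^ 2
  have hF : ∀ q ∈ Q, F q ≠ 0 := by
    intro q hq h0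
    have h1 : wedge (q - x) (a - p) = 0 := by
      simpa [F, Polynomial.coeff_X, Polynomial.coeff_C] using congrArg (Polynomial.coeff · 1) h0
    have h2 : wedge (q - x) (b - p) = 0 := by
      simpa [F, Polynomial.coeff_X, Polynomial.coeff_C] using congrArg (Polynomial.coeff · 2) h0
    have hqx : q - x ≠ 0 := sub_ne_zero.mpr fun h => hx (h ▸ hq)
    obtain ⟨r, hr⟩ := exists_smul_of_wedge_eq_zero hqx h1
    obtain ⟨s, hs⟩ := exists_smul_of_wedge_eq_zero hqx h2
    apply h
    rw [hr, hs, wedge_smul_left, wedge_smul_right, wedge_self_zero, mul_zero, mul_zero]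
  have hfin : (⋃ q ∈ Q, {τ : ℝ | (F q).IsRoot τ}).Finite :=
    Q.finite_toSet.biUnion fun q hq => Polynomial.finite_setOfPred_isRoot (hF q hq)
  obtain ⟨τ, ⟨h0, h1⟩, hτ⟩ :=
    (Set.Ioo_infinite (show (0 : ℝ) < 1 / 2 by norm_num)).exists_notMem_finite hfin
  simp only [Set.mem_iUnion, Set.mem_ofPred_eq, not_exists] at hτ
  refine ⟨p + τ • (a - p) + τ ^ 2 • (b - p), mem_convexHull_triple.mpr
    ⟨τ, τ ^ 2, h0.le, by positivity, by nlinarith, by abel⟩, fun q hq h2 => hτ q hq ?_⟩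
  have h3 : p + τ • (a - p) + τ ^ 2 • (b - p) - x
      = (p - x) + (τ • (a - p) + τ ^ 2 • (b - p)) := by abel
  rw [h3, wedge_add_right, wedge_add_right, wedge_smul_right, wedge_smul_right] at h2
  simp only [F, Polynomial.IsRoot, Polynomial.eval_add, Polynomial.eval_mul, Polynomial.eval_C,
    Polynomial.eval_X, Polynomial.eval_pow]
  linarith

/-- The dual graph of a triangulation is connected: a proper nonempty set of triangles shares an
edge with its complement. -/
lemma IsTriangulationOf.exists_shared_edge {D S : Finset (Finset Pt)} {P : Finset Pt}
    (hT : IsTriangulationOf D P) (hSD : S ⊆ D) (hS : S.Nonempty) (hne : S ≠ D) :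
    ∃ t ∈ D, t ∉ S ∧ ∃ e ∈ edgesOf S, e ⊆ t := by
  obtain ⟨s, hs⟩ := hS
  obtain ⟨t, ht, htS⟩ : ∃ t ∈ D, t ∉ S := by
    by_contra! h; exact hne (hSD.antisymm h)
  obtain ⟨p, a, b, -, -, -, rfl⟩ := Finset.card_eq_three.mp (hT.card3 t ht)
  obtain ⟨p', a', b', hpa', -, -, rfl⟩ := Finset.card_eq_three.mp (hT.card3 s (hSD hs))
  have hinf : (convexHull ℝ ({p', a', b'} : Set Pt)).Infinite := by
    have hseg : (segment ℝ p' a').Infinite := by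
      rw [segment_eq_image_lineMap]
      exact (Set.Icc_infinite one_pos).image
        (AffineMap.lineMap_injective ℝ hpa').injOn
    refine hseg.mono ?_
    rw [← convexHull_pair]
    exact convexHull_mono (by intro q; simp; tauto)
  obtain ⟨x, hxs, hxP⟩ := hinf.exists_notMem_finset P
  obtain ⟨y, hyt, hy⟩ := exists_mem_convexHull_wedge_ne_zero (hT.wedge_ne_zero ht) P hxP
  have hclosed : ∀ R : Finset (Finset Pt), IsClosed (⋃ t ∈ R, convexHull ℝ (t : Set Pt)) :=
    fun R => R.finite_toSet.isClosed_biUnion fun t _ =>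
      (t.finite_toSet.isCompact_convexHull ℝ).isClosed
  have hxs' : x ∈ convexHull ℝ (({p', a', b'} : Finset Pt) : Set Pt) := by simpa using hxs
  have hyt' : y ∈ convexHull ℝ (({p, a, b} : Finset Pt) : Set Pt) := by simpa using hyt
  have hsub : segment ℝ x y ⊆ (⋃ t ∈ S, convexHull ℝ (t : Set Pt)) ∪
      ⋃ t ∈ D \ S, convexHull ℝ (t : Set Pt) := by
    intro z hz
    have hzP : z ∈ convexHull ℝ (P : Set Pt) :=
      (convex_convexHull ℝ _).segment_subset
        (convexHull_mono (Finset.coe_subset.mpr (hT.subset _ (hSD hs))) hxs')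
        (convexHull_mono (Finset.coe_subset.mpr (hT.subset _ ht)) hyt') hz
    rw [← hT.cover] at hzP
    simp only [Set.mem_iUnion, Set.mem_union, Finset.mem_sdiff] at hzP ⊢
    obtain ⟨u, hu, hzu⟩ := hzP
    by_cases huS : u ∈ S
    · exact Or.inl ⟨u, huS, hzu⟩
    · exact Or.inr ⟨u, ⟨hu, huS⟩, hzu⟩
  obtain ⟨z, hz, hzU, hzV⟩ := isPreconnected_closed_iff.mp (convex_segment x y).isPreconnected _ _
    (hclosed S) (hclosed (D \ S)) hsub
    ⟨x, left_mem_segment ℝ x y, Set.mem_biUnion hs hxs'⟩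
    ⟨y, right_mem_segment ℝ x y, Set.mem_biUnion (Finset.mem_sdiff.mpr ⟨ht, htS⟩) hyt'⟩
  simp only [Set.mem_iUnion, Finset.mem_sdiff] at hzU hzV
  obtain ⟨u, huS, hzu⟩ := hzU
  obtain ⟨v, ⟨hvD, hvS⟩, hzv⟩ := hzV
  have hzP : z ∉ P := by
    intro hzP
    apply hy z hzP
    obtain ⟨c, d, -, -, hcd, rfl⟩ := hz
    obtain rfl : c = 1 - d := by linarith
    rw [show (1 - d) • x + d • y - x = d • (y - x) by module, wedge_smul_left, wedge_self_zero,
      mul_zero]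
  have hzi := hT.mem_convexHull_inter (hSD huS) hvD hzu hzv
  have hcard : 2 ≤ (u ∩ v).card := by
    by_contra! hlt
    have hne : (u ∩ v).Nonempty := by
      have := convexHull_nonempty_iff.mp ⟨z, hzi⟩
      exact_mod_cast this
    have h1 : (u ∩ v).card = 1 := by have := hne.card_pos; omega
    obtain ⟨q, hq⟩ := Finset.card_eq_one.mp h1
    rw [hq] at hzi
    have hzq : z = q := by simpa using hzi
    have hqu : q ∈ u := (Finset.mem_inter.mp (hq ▸ Finset.mem_singleton_self q)).1
    exact hzP (hzq ▸ hT.subset u (hSD huS) hqu)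
  obtain ⟨e, he, hec⟩ := Finset.exists_subset_card_eq hcard
  exact ⟨v, hvD, hvS, e, Finset.mem_biUnion.mpr ⟨u, huS, Finset.mem_powersetCard.mpr
    ⟨he.trans Finset.inter_subset_left, hec⟩⟩, he.trans Finset.inter_subset_right⟩

/-- The endpoints other than `p` of the edges of `D` at `p`. -/
def nbrs (D : Finset (Finset Pt)) (p : Pt) : Finset Pt :=
  ((D.filter (fun t => p ∈ t)).biUnion id).erase p

/-- The pairs `(a, b)` such that `p, a, b` is a counterclockwise oriented triangle of `D`. -/
def links (D : Finset (Finset Pt)) (p : Pt) : Finset (Pt × Pt) :=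
  (nbrs D p ×ˢ nbrs D p).filter
    fun x => {p, x.1, x.2} ∈ D ∧ 0 < wedge (x.1 - p) (x.2 - p)

lemma mem_nbrs {D : Finset (Finset Pt)} {p a : Pt} :
    a ∈ nbrs D p ↔ a ≠ p ∧ ∃ t ∈ D, p ∈ t ∧ a ∈ t := by
  simp [nbrs, and_assoc]

lemma card_edges_at_vertex (D : Finset (Finset Pt)) (p : Pt) :
    ((edgesOf D).filter (fun e => p ∈ e)).card = (nbrs D p).card := by
  have h : (edgesOf D).filter (fun e => p ∈ e) = (nbrs D p).image (fun a => {p, a}) := by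
    ext e
    simp only [edgesOf, Finset.mem_filter, Finset.mem_biUnion, Finset.mem_powersetCard,
      Finset.mem_image, mem_nbrs]
    constructor
    · rintro ⟨⟨t, ht, het, hc⟩, hp⟩
      have h1 : (e.erase p).card = 1 := by rw [Finset.card_erase_of_mem hp, hc]
      obtain ⟨a, ha⟩ := Finset.card_eq_one.mp h1
      have hae : a ∈ e.erase p := ha ▸ Finset.mem_singleton_self a
      obtain ⟨hap, hae⟩ := Finset.mem_erase.mp hae
      exact ⟨a, ⟨hap, t, ht, het hp, het hae⟩, by rw [← ha, Finset.insert_erase hp]⟩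
    · rintro ⟨a, ⟨hap, t, ht, hp, ha⟩, rfl⟩
      exact ⟨⟨t, ht, Finset.insert_subset hp (Finset.singleton_subset_iff.mpr ha),
        Finset.card_pair hap.symm⟩, by simp⟩
  rw [h, Finset.card_image_of_injOn]
  intro a ha b hb hab
  have hap := (mem_nbrs.mp ha).1
  have : a ∈ ({p, b} : Finset Pt) := by
    rw [← show ({p, a} : Finset Pt) = {p, b} from hab]; simp
  simpa [hap] using this

namespace IsTriangulationOf

variable {D : Finset (Finset Pt)} {P : Finset Pt}

lemma mem_links (hT : IsTriangulationOf D P) {p a b : Pt} :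
    (a, b) ∈ links D p ↔ {p, a, b} ∈ D ∧ 0 < wedge (a - p) (b - p) := by
  simp only [links, Finset.mem_filter, Finset.mem_product, mem_nbrs, and_iff_right_iff_imp]
  rintro ⟨h, -⟩
  obtain ⟨hpa, hpb, -⟩ := Finset.card_triple_eq_three_iff.mp (hT.card3 _ h)
  exact ⟨⟨hpa.symm, _, h, by simp, by simp⟩, hpb.symm, _, h, by simp, by simp⟩

lemma sum_triangles_at_vertex (hT : IsTriangulationOf D P) (p : Pt) (F : Finset Pt → ℝ) :
    ∑ t ∈ D.filter (fun t => p ∈ t), F t = ∑ x ∈ links D p, F {p, x.1, x.2} := by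
  symm
  refine Finset.sum_bij (fun x _ => {p, x.1, x.2}) ?_ ?_ ?_ fun _ _ => rfl
  · rintro ⟨a, b⟩ h
    exact Finset.mem_filter.mpr ⟨(hT.mem_links.mp h).1, by simp⟩
  · rintro ⟨a, b⟩ h ⟨c, d⟩ h' heq
    obtain ⟨h1, h2⟩ := hT.mem_links.mp h
    obtain ⟨h1', h2'⟩ := hT.mem_links.mp h'
    obtain ⟨hpa, hpb, hab⟩ := Finset.card_triple_eq_three_iff.mp (hT.card3 _ h1)
    dsimp only at heq
    have ha : a ∈ ({p, c, d} : Finset Pt) := by rw [← heq]; simp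
    have hb : b ∈ ({p, c, d} : Finset Pt) := by rw [← heq]; simp
    simp only [Finset.mem_insert, Finset.mem_singleton, hpa.symm, hpb.symm, false_or] at ha hb
    rcases ha with rfl | rfl <;> rcases hb with rfl | rfl
    · exact absurd rfl hab
    · rfl
    · rw [wedge_swap] at h2; linarith
    · exact absurd rfl hab
  · intro t ht
    obtain ⟨ht, hp⟩ := Finset.mem_filter.mp ht
    obtain ⟨a, b, rfl⟩ := exists_eq_triple_of_mem (hT.card3 t ht) hp
    have hswap : ({p, b, a} : Finset Pt) = {p, a, b} := by rw [Finset.pair_comm]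
    rcases lt_or_gt_of_ne (hT.wedge_ne_zero ht) with h | h
    · refine ⟨(b, a), hT.mem_links.mpr ⟨hswap ▸ ht, ?_⟩, hswap⟩
      rw [wedge_swap]; linarith
    · exact ⟨(a, b), hT.mem_links.mpr ⟨ht, h⟩, rfl⟩

lemma card_triangles_at_vertex (hT : IsTriangulationOf D P) (p : Pt) :
    (D.filter (fun t => p ∈ t)).card = (links D p).card := by
  have := hT.sum_triangles_at_vertex p fun _ => 1
  simp only [Finset.sum_const, nsmul_eq_mul, mul_one] at this
  exact_mod_cast this

lemma bdryAngle_eq_sum_links (hT : IsTriangulationOf D P) (p : Pt) :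
    bdryAngle D p = ∑ x ∈ links D p, EuclideanGeometry.angle x.1 p x.2 := by
  rw [bdryAngle, hT.sum_triangles_at_vertex p fun t => oppAngle p (t.erase p)]
  refine Finset.sum_congr rfl ?_
  rintro ⟨a, b⟩ h
  exact oppAngle_erase_triple (hT.card3 _ (hT.mem_links.mp h).1)

lemma injOn_fst_links (hT : IsTriangulationOf D P) (p : Pt) :
    Set.InjOn Prod.fst (links D p : Set (Pt × Pt)) := by
  rintro ⟨a, b⟩ h ⟨c, d⟩ h' heq
  obtain rfl : a = c := heq
  obtain ⟨h1, h2⟩ := hT.mem_links.mp h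
  obtain ⟨h1', h2'⟩ := hT.mem_links.mp h'
  rw [hT.triangle_on_side_unique h1 h1' (mul_pos h2 h2')]

lemma injOn_snd_links (hT : IsTriangulationOf D P) (p : Pt) :
    Set.InjOn Prod.snd (links D p : Set (Pt × Pt)) := by
  rintro ⟨a, b⟩ h ⟨c, d⟩ h' heq
  obtain rfl : b = d := heq
  obtain ⟨h1, h2⟩ := hT.mem_links.mp h
  obtain ⟨h1', h2'⟩ := hT.mem_links.mp h'
  rw [Finset.pair_comm] at h1 h1'
  rw [wedge_swap] at h2 h2'
  rw [hT.triangle_on_side_unique h1 h1' (by nlinarith)]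

lemma exists_link_of_wedge_pos (hT : IsTriangulationOf D P) {p a q : Pt} (ha : a ∈ nbrs D p)
    (hq : q ∈ convexHull ℝ (P : Set Pt)) (h : 0 < wedge (a - p) (q - p)) :
    ∃ b, (a, b) ∈ links D p := by
  obtain ⟨hap, t, ht, hpt, hat⟩ := mem_nbrs.mp ha
  obtain ⟨b, hb, hpos⟩ := hT.exists_triangle_on_side ht hpt hat hap.symm hq h.ne'
  exact ⟨b, hT.mem_links.mpr ⟨hb, pos_of_mul_pos_left hpos h.le⟩⟩

lemma exists_link_of_wedge_neg (hT : IsTriangulationOf D P) {p a q : Pt} (ha : a ∈ nbrs D p)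
    (hq : q ∈ convexHull ℝ (P : Set Pt)) (h : wedge (a - p) (q - p) < 0) :
    ∃ b, (b, a) ∈ links D p := by
  obtain ⟨hap, t, ht, hpt, hat⟩ := mem_nbrs.mp ha
  obtain ⟨b, hb, hpos⟩ := hT.exists_triangle_on_side ht hpt hat hap.symm hq h.ne
  rw [Finset.pair_comm] at hb
  refine ⟨b, hT.mem_links.mpr ⟨hb, ?_⟩⟩
  rw [wedge_swap]
  nlinarith

lemma image_fst_links_subset (D : Finset (Finset Pt)) (p : Pt) :
    (links D p).image Prod.fst ⊆ nbrs D p := by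
  intro a ha
  obtain ⟨x, hx, rfl⟩ := Finset.mem_image.mp ha
  exact (Finset.mem_product.mp (Finset.mem_filter.mp hx).1).1

lemma image_snd_links_subset (D : Finset (Finset Pt)) (p : Pt) :
    (links D p).image Prod.snd ⊆ nbrs D p := by
  intro a ha
  obtain ⟨x, hx, rfl⟩ := Finset.mem_image.mp ha
  exact (Finset.mem_product.mp (Finset.mem_filter.mp hx).1).2

end IsTriangulationOf

lemma exists_pos_add_smul_mem_of_mem_interior {K : Set Pt} {p : Pt} (hp : p ∈ interior K) (v : Pt) :
    ∃ s : ℝ, 0 < s ∧ p + s • v ∈ K := by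
  have hf : Continuous fun s : ℝ => p + s • v := by fun_prop
  have h : ∀ᶠ s in nhdsWithin (0 : ℝ) (Set.Ioi 0), p + s • v ∈ K := by
    refine nhdsWithin_le_nhds (hf.continuousAt.eventually ?_)
    simpa using mem_interior_iff_mem_nhds.mp hp
  obtain ⟨s, hs, hs0⟩ := (h.and self_mem_nhdsWithin).exists
  exact ⟨s, hs0, hs⟩

lemma exists_wedge_pos {u : Pt} (hu : u ≠ 0) : ∃ v, 0 < wedge u v := by
  by_contra! h
  apply hu
  have h0 := h !₂[0, u 0]
  have h1 := h !₂[-u 1, 0]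
  simp only [wedge, Matrix.cons_val_zero, Matrix.cons_val_one] at h0 h1
  ext i
  fin_cases i
  · simp only [Fin.zero_eta, PiLp.zero_apply]; nlinarith [sq_nonneg (u 0)]
  · simp only [Fin.mk_one, PiLp.zero_apply]; nlinarith [sq_nonneg (u 1)]

namespace IsTriangulationOf

variable {D : Finset (Finset Pt)} {P : Finset Pt}

lemma image_fst_links_of_interior (hT : IsTriangulationOf D P) {p : Pt}
    (hp : p ∈ interior (convexHull ℝ (P : Set Pt))) :
    (links D p).image Prod.fst = nbrs D p := by
  refine (image_fst_links_subset D p).antisymm fun a ha => ?_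
  obtain ⟨v, hv⟩ := exists_wedge_pos (sub_ne_zero.mpr (mem_nbrs.mp ha).1)
  obtain ⟨s, hs, hsK⟩ := exists_pos_add_smul_mem_of_mem_interior hp v
  obtain ⟨b, hb⟩ := hT.exists_link_of_wedge_pos ha hsK
    (by rw [add_sub_cancel_left, wedge_smul_right]; positivity)
  exact Finset.mem_image_of_mem Prod.fst hb

lemma image_snd_links_of_interior (hT : IsTriangulationOf D P) {p : Pt}
    (hp : p ∈ interior (convexHull ℝ (P : Set Pt))) :
    (links D p).image Prod.snd = nbrs D p := by
  refine (image_snd_links_subset D p).antisymm fun a ha => ?_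
  obtain ⟨v, hv⟩ := exists_wedge_pos (sub_ne_zero.mpr (mem_nbrs.mp ha).1)
  obtain ⟨s, hs, hsK⟩ := exists_pos_add_smul_mem_of_mem_interior hp (-v)
  obtain ⟨b, hb⟩ := hT.exists_link_of_wedge_neg ha hsK (by
    rw [add_sub_cancel_left, smul_neg, ← neg_smul, wedge_smul_right, neg_mul]
    exact neg_neg_of_pos (mul_pos hs hv))
  exact Finset.mem_image_of_mem Prod.snd hb

lemma interior_convexHull_nonempty {t : Finset Pt} (hT : IsTriangulationOf D P) (ht : t ∈ D) :
    (interior (convexHull ℝ (P : Set Pt))).Nonempty := by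
  have h : (interior (convexHull ℝ (t : Set Pt))).Nonempty := by
    rw [interior_convexHull_nonempty_iff_affineSpan_eq_top]
    have := (hT.indep t ht).affineSpan_eq_top_iff_card_eq_finrank_add_one.mpr
      (by simp [hT.card3 t ht])
    simpa using this
  exact h.mono (interior_mono (convexHull_mono (Finset.coe_subset.mpr (hT.subset t ht))))

lemma exists_supporting_direction {t : Finset Pt} (hT : IsTriangulationOf D P) (ht : t ∈ D) {p : Pt}
    (hp : p ∉ interior (convexHull ℝ (P : Set Pt))) :
    ∃ w : Pt, w ≠ 0 ∧ ∀ q ∈ P, 0 ≤ wedge w (q - p) := by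
  obtain ⟨f, hf, hfP⟩ := geometric_hahn_banach_of_nonempty_interior_point (convex_convexHull ℝ _) hp
    (hT.interior_convexHull_nonempty ht)
  have hw : ∀ v : Pt, wedge !₂[-f !₂[0, 1], f !₂[1, 0]] v = - f v := by
    intro v
    have hv : v = v 0 • !₂[1, 0] + v 1 • !₂[0, 1] := by
      ext i; fin_cases i <;> simp
    conv_rhs => rw [hv]
    simp only [wedge, map_add, map_smul, smul_eq_mul, Matrix.cons_val_zero,
      Matrix.cons_val_one]
    ring
  refine ⟨!₂[-f !₂[0, 1], f !₂[1, 0]], ?_, fun q hq => ?_⟩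
  · intro h0
    apply hf
    ext v
    have := hw v
    rw [h0] at this
    simp only [wedge, PiLp.zero_apply, zero_mul, sub_zero] at this
    simpa using this.symm
  · rw [hw, map_sub]
    linarith [hfP q (subset_convexHull ℝ _ hq)]

lemma exists_nbr_without_link (hT : IsTriangulationOf D P) {p : Pt} (hpP : p ∈ P)
    (hp : p ∉ interior (convexHull ℝ (P : Set Pt))) :
    ∃ a ∈ nbrs D p, ∀ b, (a, b) ∉ links D p := by
  obtain ⟨t, ht, hpt⟩ := hT.vertex p hpP
  obtain ⟨w, hw0, hw⟩ := hT.exists_supporting_direction ht hp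
  have hnP : ∀ a ∈ nbrs D p, a ∈ P := fun a ha => by
    obtain ⟨-, s, hs, -, has⟩ := mem_nbrs.mp ha
    exact hT.subset s hs has
  have hlink : ∀ {a b}, (a, b) ∈ links D p → b ∈ nbrs D p := fun h =>
    image_snd_links_subset D p (Finset.mem_image_of_mem Prod.snd h)
  by_cases hneg : ∃ a ∈ nbrs D p, ∃ c : ℝ, c < 0 ∧ a - p = c • w
  · obtain ⟨a, ha, c, hc, hac⟩ := hneg
    refine ⟨a, ha, fun b hb => ?_⟩
    have h1 := (hT.mem_links.mp hb).2
    have h2 := hw b (hnP b (hlink hb))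
    rw [hac, wedge_smul_left] at h1
    nlinarith
  push Not at hneg
  have hpar : ∀ a ∈ nbrs D p, wedge w (a - p) = 0 → ∃ c : ℝ, 0 < c ∧ a - p = c • w := by
    intro a ha h0
    obtain ⟨c, hc⟩ := exists_smul_of_wedge_eq_zero hw0 h0
    refine ⟨c, ?_, hc⟩
    by_contra! hle
    rcases hle.lt_or_eq with hlt | rfl
    · exact hneg a ha c hlt hc
    · rw [zero_smul, sub_eq_zero] at hc
      exact (mem_nbrs.mp ha).1 hc
  have hne : ((nbrs D p).filter fun a => 0 < wedge w (a - p)).Nonempty := by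
    obtain ⟨a, b, rfl⟩ := exists_eq_triple_of_mem (hT.card3 t ht) hpt
    obtain ⟨hpa, hpb, -⟩ := Finset.card_triple_eq_three_iff.mp (hT.card3 _ ht)
    have ha : a ∈ nbrs D p := mem_nbrs.mpr ⟨hpa.symm, _, ht, by simp, by simp⟩
    have hb : b ∈ nbrs D p := mem_nbrs.mpr ⟨hpb.symm, _, ht, by simp, by simp⟩
    by_contra hemp
    rw [Finset.not_nonempty_iff_eq_empty, Finset.filter_eq_empty_iff] at hemp
    obtain ⟨c, -, hc⟩ := hpar a ha (le_antisymm (not_lt.mp (hemp ha)) (hw a (hnP a ha)))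
    obtain ⟨d, -, hd⟩ := hpar b hb (le_antisymm (not_lt.mp (hemp hb)) (hw b (hnP b hb)))
    apply hT.wedge_ne_zero ht
    rw [hc, hd, wedge_smul_left, wedge_smul_right, wedge_self_zero, mul_zero, mul_zero]
  obtain ⟨a, ha, hmin⟩ := Finset.exists_min_image _
    (fun a => (w 0 * (a - p) 0 + w 1 * (a - p) 1) / wedge w (a - p)) hne
  obtain ⟨ha, hapos⟩ := Finset.mem_filter.mp ha
  refine ⟨a, ha, fun b hb => ?_⟩
  have hab := (hT.mem_links.mp hb).2
  have hbn := hlink hb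
  rcases (hw b (hnP b hbn)).eq_or_lt with h0 | hbpos
  · obtain ⟨c, hc, hbc⟩ := hpar b hbn h0.symm
    rw [hbc, wedge_smul_right, wedge_swap] at hab
    nlinarith
  · have h := hmin b (Finset.mem_filter.mpr ⟨hbn, hbpos⟩)
    rw [div_le_div_iff₀ hapos hbpos] at h
    have hid : (w 0 * (b - p) 0 + w 1 * (b - p) 1) * wedge w (a - p)
        - (w 0 * (a - p) 0 + w 1 * (a - p) 1) * wedge w (b - p)
        = -((w 0 ^ 2 + w 1 ^ 2) * wedge (a - p) (b - p)) := by
      simp only [wedge]; ring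
    have hw2 := sq_add_sq_pos_of_ne_zero hw0
    have := mul_pos hw2 hab
    linarith

lemma nbr_without_link_unique (hT : IsTriangulationOf D P) (hcol : ¬ Collinear ℝ (P : Set Pt))
    {p a b : Pt} (hpP : p ∈ P) (ha : a ∈ nbrs D p) (hb : b ∈ nbrs D p)
    (hla : ∀ c, (a, c) ∉ links D p) (hlb : ∀ c, (b, c) ∉ links D p) : a = b := by
  have key : ∀ {a}, a ∈ nbrs D p → (∀ c, (a, c) ∉ links D p) →
      ∀ q ∈ P, wedge (a - p) (q - p) ≤ 0 := by
    intro a ha hla q hq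
    by_contra! h
    obtain ⟨c, hc⟩ := hT.exists_link_of_wedge_pos ha (subset_convexHull ℝ _ hq) h
    exact hla c hc
  obtain ⟨hap, t, ht, hpt, hat⟩ := mem_nbrs.mp ha
  obtain ⟨hbp, t', ht', hpt', hbt⟩ := mem_nbrs.mp hb
  have h1 := key ha hla b (hT.subset t' ht' hbt)
  have h2 := key hb hlb a (hT.subset t ht hat)
  rw [wedge_swap] at h2
  obtain ⟨r, hr⟩ := exists_smul_of_wedge_eq_zero (sub_ne_zero.mpr hap) (le_antisymm h1 (by linarith))
  rcases lt_trichotomy r 0 with hr0 | rfl | hr0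
  · refine absurd (collinear_of_wedge_eq_zero (Finset.mem_coe.mpr hpP) hap fun q hq => ?_) hcol
    have h3 := key ha hla q hq
    have h4 := key hb hlb q hq
    rw [hr, wedge_smul_left] at h4
    nlinarith
  · rw [zero_smul, sub_eq_zero] at hr
    exact absurd hr hbp
  · exact hT.neighbor_eq_of_smul ht ht' hpt hat hpt' hbt hap.symm hbp.symm hr0 hr

lemma card_nbrs_of_boundary (hT : IsTriangulationOf D P) (hcol : ¬ Collinear ℝ (P : Set Pt))
    {p : Pt} (hpP : p ∈ P) (hp : p ∉ interior (convexHull ℝ (P : Set Pt))) :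
    (nbrs D p).card = (links D p).card + 1 := by
  obtain ⟨a, ha, hla⟩ := hT.exists_nbr_without_link hpP hp
  have himg : (links D p).image Prod.fst = (nbrs D p).erase a := by
    ext c
    rw [Finset.mem_erase]
    constructor
    · intro hc
      refine ⟨?_, image_fst_links_subset D p hc⟩
      rintro rfl
      obtain ⟨⟨c, d⟩, hx, rfl⟩ := Finset.mem_image.mp hc
      exact hla d hx
    · rintro ⟨hca, hc⟩
      by_contra hno
      exact hca (hT.nbr_without_link_unique hcol hpP hc ha
        (fun d hd => hno (Finset.mem_image_of_mem Prod.fst hd)) hla)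
  rw [← Finset.card_image_of_injOn (hT.injOn_fst_links p), himg, Finset.card_erase_add_one ha]

end IsTriangulationOf

lemma im_div_pos {z w : ℂ} (h : 0 < z.re * w.im - z.im * w.re) : 0 < (w / z).im := by
  have hz : 0 < Complex.normSq z := by
    rw [Complex.normSq_pos]; rintro rfl; simp at h
  rw [Complex.div_im, ← sub_div]
  exact div_pos (by linarith) hz

lemma arg_pos_of_im_pos {z : ℂ} (h : 0 < z.im) : 0 < z.arg := by
  refine lt_of_le_of_ne (Complex.arg_nonneg_iff.mpr h.le) fun h0 => h.ne' ?_
  exact (Complex.arg_eq_zero_iff.mp h0.symm).2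

lemma im_pos_of_arg_mem_Ioo {z : ℂ} (h0 : 0 < z.arg) (hpi : z.arg < π) : 0 < z.im := by
  rw [← Complex.norm_mul_sin_arg]
  refine mul_pos (norm_pos_iff.mpr ?_) (Real.sin_pos_of_pos_of_lt_pi h0 hpi)
  rintro rfl
  simp at h0

/-- The angle between two complex numbers is the difference of their arguments, up to a full turn
exactly when the counterclockwise sector between them meets the branch cut. -/
lemma complex_angle_eq_arg_sub_arg {z w : ℂ} (h : 0 < z.re * w.im - z.im * w.re)
    (hcut : z.arg ≠ π → ¬ (0 < z.im ∧ w.im < 0)) :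
    InnerProductGeometry.angle z w = w.arg - z.arg + if z.arg = π then 2 * π else 0 := by
  have hz : z ≠ 0 := by rintro rfl; simp at h
  have hw : w ≠ 0 := by rintro rfl; simp at h
  have him := im_div_pos h
  have hpos := arg_pos_of_im_pos him
  have hlt : (w / z).arg < π := Complex.arg_lt_pi_iff.mpr (Or.inr him.ne')
  rw [InnerProductGeometry.angle_comm, Complex.angle_eq_abs_arg hw hz, abs_of_pos hpos]
  have hk := Complex.arg_div_coe_angle hw hz
  rw [← Real.Angle.coe_sub, Real.Angle.angle_eq_iff_two_pi_dvd_sub] at hk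
  obtain ⟨k, hk⟩ := hk
  have hz1 := Complex.neg_pi_lt_arg z
  have hz2 := Complex.arg_le_pi z
  have hw1 := Complex.neg_pi_lt_arg w
  have hw2 := Complex.arg_le_pi w
  have hpi := Real.pi_pos
  have hk0 : -1 < k := by
    have : (-1 : ℝ) < k := by nlinarith
    exact_mod_cast this
  have hk2 : k < 2 := by
    have : (k : ℝ) < 2 := by nlinarith
    exact_mod_cast this
  obtain rfl | rfl : k = 0 ∨ k = 1 := by omega
  · push_cast at hk
    split_ifs with hzpi
    · linarith
    · linarith
  · push_cast at hk
    split_ifs with hzpi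
    · linarith
    · have hzlt : z.arg < π := lt_of_le_of_ne hz2 hzpi
      refine absurd ⟨im_pos_of_arg_mem_Ioo (by linarith) hzlt, ?_⟩ (hcut hzpi)
      exact Complex.arg_neg_iff.mp (by linarith)

/-- The plane vector `v` as a complex number, rotated and scaled so that `u` becomes negative real. -/
def rotated (u v : Pt) : ℂ := ⟨-(u 0 * v 0 + u 1 * v 1), -wedge u v⟩

lemma rotated_eq (u v : Pt) :
    rotated u v = ⟨-u 0, u 1⟩ * Complex.orthonormalBasisOneI.repr.symm v := by
  rw [Complex.orthonormalBasisOneI_repr_symm_apply]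
  apply Complex.ext <;> simp [rotated, wedge] <;> ring

lemma angle_eq_angle_rotated {u : Pt} (hu : u ≠ 0) (v w : Pt) :
    InnerProductGeometry.angle v w = InnerProductGeometry.angle (rotated u v) (rotated u w) := by
  have h : (⟨-u 0, u 1⟩ : ℂ) ≠ 0 := by
    intro h
    have h0 := congrArg Complex.re h
    have h1 := congrArg Complex.im h
    apply hu
    ext i
    fin_cases i
    · simpa using h0
    · simpa using h1
  rw [rotated_eq, rotated_eq, Complex.angle_mul_left h]
  exact (LinearIsometry.angle_map
    Complex.orthonormalBasisOneI.repr.symm.toLinearIsometry v w).symm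

namespace IsTriangulationOf

variable {D : Finset (Finset Pt)} {P : Finset Pt}

/-- No edge at `p` points strictly inside the angle at `p` of a triangle. -/
lemma not_nbr_inside_angle (hT : IsTriangulationOf D P) {p a b c : Pt} (hab : (a, b) ∈ links D p)
    (hc : c ∈ nbrs D p) :
    ¬ (0 < wedge (a - p) (c - p) ∧ 0 < wedge (c - p) (b - p)) := by
  rintro ⟨hac, hcb⟩
  obtain ⟨htri, hpos⟩ := hT.mem_links.mp hab
  obtain ⟨hcp, t, ht, hpt, hct⟩ := mem_nbrs.mp hc
  set l := wedge (c - p) (b - p) / wedge (a - p) (b - p) with hl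
  set μ := wedge (a - p) (c - p) / wedge (a - p) (b - p) with hμ
  have hl0 : 0 < l := div_pos hcb hpos
  have hμ0 : 0 < μ := div_pos hac hpos
  have hcl : c - p = l • (a - p) + μ • (b - p) := eq_smul_add_smul_of_wedge_ne_zero hpos.ne' _
  set ε := 1 / (1 + l + μ) with hε
  have hε0 : 0 < ε := by positivity
  have hεeq : ε * 1 + ε * l + ε * μ = 1 := by rw [hε]; field_simp
  have hεl : 0 < ε * l := by positivity
  have hεμ : 0 < ε * μ := by positivity
  have hxo : p + ε • (c - p) ∈ openSegment ℝ p c :=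
    ⟨1 - ε, ε, by linarith, hε0, by ring, by module⟩
  have hxt : p + ε • (c - p) ∈ convexHull ℝ (({p, a, b} : Finset Pt) : Set Pt) := by
    push_cast
    exact mem_convexHull_triple.mpr ⟨ε * l, ε * μ, hεl.le, hεμ.le, by linarith,
      by rw [hcl]; module⟩
  have hmem := (hT.edge_subset ht htri hpt hct hcp.symm hxo hxt).2
  simp only [Finset.mem_insert, Finset.mem_singleton] at hmem
  rcases hmem with rfl | rfl | rfl
  · exact hcp rfl
  · exact hac.ne' (wedge_self_zero _)
  · exact hcb.ne' (wedge_self_zero _)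

/-- The angles around an interior vertex sum to a full turn. -/
lemma bdryAngle_of_interior (hT : IsTriangulationOf D P) {p : Pt} (hpP : p ∈ P)
    (hp : p ∈ interior (convexHull ℝ (P : Set Pt))) : bdryAngle D p = 2 * π := by
  obtain ⟨t, ht, hpt⟩ := hT.vertex p hpP
  obtain ⟨c, c', rfl⟩ := exists_eq_triple_of_mem (hT.card3 t ht) hpt
  obtain ⟨hpc, -, -⟩ := Finset.card_triple_eq_three_iff.mp (hT.card3 _ ht)
  have hc : c ∈ nbrs D p := mem_nbrs.mpr ⟨hpc.symm, _, ht, by simp, by simp⟩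
  have hu : c - p ≠ 0 := sub_ne_zero.mpr hpc.symm
  have hu2 := sq_add_sq_pos_of_ne_zero hu
  let θ : Pt → ℝ := fun a => (rotated (c - p) (a - p)).arg
  have hθ : ∀ a ∈ nbrs D p, (θ a = π ↔ a = c) := by
    intro a ha
    rw [Complex.arg_eq_pi_iff]
    constructor
    · rintro ⟨hre, him⟩
      obtain ⟨r, hr⟩ := exists_smul_of_wedge_eq_zero hu (neg_eq_zero.mp him)
      obtain ⟨hap, s, hs, hps, has⟩ := mem_nbrs.mp ha
      refine (hT.neighbor_eq_of_smul ht hs (by simp) (by simp) hps has hpc hap.symm ?_ hr).symm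
      simp only [rotated, hr, PiLp.smul_apply, smul_eq_mul] at hre
      by_contra! hle
      nlinarith
    · rintro rfl
      refine ⟨?_, by simp [rotated, wedge_self_zero]⟩
      simp only [rotated]
      linarith
  have hangle : ∀ x ∈ links D p, EuclideanGeometry.angle x.1 p x.2
      = θ x.2 - θ x.1 + if x.1 = c then 2 * π else 0 := by
    rintro ⟨a, b⟩ hab
    have ha : a ∈ nbrs D p := image_fst_links_subset D p (Finset.mem_image_of_mem Prod.fst hab)
    simp only [← hθ a ha]
    rw [EuclideanGeometry.angle, vsub_eq_sub, vsub_eq_sub, angle_eq_angle_rotated hu]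
    refine complex_angle_eq_arg_sub_arg ?_ fun _ h => ?_
    · have hid : (rotated (c - p) (a - p)).re * (rotated (c - p) (b - p)).im
          - (rotated (c - p) (a - p)).im * (rotated (c - p) (b - p)).re
          = ((c - p) 0 ^ 2 + (c - p) 1 ^ 2) * wedge (a - p) (b - p) := by
        simp only [rotated, wedge]; ring
      rw [hid]
      exact mul_pos hu2 (hT.mem_links.mp hab).2
    · refine hT.not_nbr_inside_angle hab hc ⟨?_, ?_⟩
      · rw [wedge_swap]; exact h.1
      · exact neg_lt_zero.mp h.2
  have hfst : ∀ F : Pt → ℝ, ∑ x ∈ links D p, F x.1 = ∑ a ∈ nbrs D p, F a := fun F => by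
    rw [← hT.image_fst_links_of_interior hp, Finset.sum_image (hT.injOn_fst_links p)]
  have hsnd : ∑ x ∈ links D p, θ x.2 = ∑ a ∈ nbrs D p, θ a := by
    rw [← hT.image_snd_links_of_interior hp, Finset.sum_image (hT.injOn_snd_links p)]
  rw [hT.bdryAngle_eq_sum_links, Finset.sum_congr rfl hangle, Finset.sum_add_distrib,
    Finset.sum_sub_distrib, hsnd, hfst θ, hfst fun a => if a = c then 2 * π else 0, sub_self,
    zero_add, Finset.sum_ite_eq', if_pos hc]

lemma card_nbrs_of_interior (hT : IsTriangulationOf D P) {p : Pt}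
    (hp : p ∈ interior (convexHull ℝ (P : Set Pt))) : (nbrs D p).card = (links D p).card := by
  rw [← hT.image_fst_links_of_interior hp, Finset.card_image_of_injOn (hT.injOn_fst_links p)]

lemma sum_pi_sub_dihedral_at_vertex (hT : IsTriangulationOf D P) (p : Pt) :
    ∑ e ∈ (edgesOf D).filter (fun e => p ∈ e), (π - dihedral D e)
      = π * ((nbrs D p).card - (links D p).card) + bdryAngle D p := by
  rw [Finset.sum_sub_distrib, sum_dihedral_at_vertex hT.card3, Finset.sum_const, nsmul_eq_mul,
    card_edges_at_vertex, hT.card_triangles_at_vertex]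
  ring

end IsTriangulationOf

/-- **Necessity assertions underlying Theorem 5.1.** Every Delaunay triangulation `D` of a
finite non-collinear set `P ⊂ ℝ²` satisfies: (i) at every interior vertex the exterior
dihedral angles sum to `2π`; (ii) at every boundary vertex they sum to `2π` together with
the exterior boundary angle; (iii) the dihedral angles of all edges sum to `π·|D|`;
(iv) every nonempty proper subset of the triangles has positive excess. -/
theorem delaunay_necessity
    (P : Finset Pt) (D : Finset (Finset Pt))
    (hcol : ¬ Collinear ℝ (P : Set Pt))
    (hD : IsDelaunay D P) :
    (∀ p ∈ P, p ∉ frontier (convexHull ℝ (P : Set Pt)) →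
      ∑ e ∈ (edgesOf D).filter (fun e => p ∈ e), (π - dihedral D e) = 2 * π) ∧
    (∀ p ∈ P, p ∈ frontier (convexHull ℝ (P : Set Pt)) →
      (∑ e ∈ (edgesOf D).filter (fun e => p ∈ e), (π - dihedral D e))
        + (π - bdryAngle D p) = 2 * π) ∧
    (∑ e ∈ edgesOf D, dihedral D e = π * D.card) ∧
    (∀ S : Finset (Finset Pt), S ⊆ D → S.Nonempty → S ≠ D →
      0 < (∑ e ∈ edgesOf S, dihedral D e) - π * S.card) := by
  have hT := hD.1
  refine ⟨fun p hpP hp => ?_, fun p hpP hp => ?_, sum_dihedral hT.card3, fun S hSD hS hne => ?_⟩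
  · have hint : p ∈ interior (convexHull ℝ (P : Set Pt)) := by
      by_contra h
      exact hp ⟨subset_closure (subset_convexHull ℝ _ hpP), h⟩
    rw [hT.sum_pi_sub_dihedral_at_vertex, hT.card_nbrs_of_interior hint,
      hT.bdryAngle_of_interior hpP hint]
    ring
  · rw [hT.sum_pi_sub_dihedral_at_vertex, hT.card_nbrs_of_boundary hcol hpP hp.2]
    push_cast
    ring
  · obtain ⟨t, ht, htS, e, he, het⟩ := hT.exists_shared_edge hSD hS hne
    exact excess_pos_of_shared_edge hT.card3 hT.indep hSD ht htS he het

end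
end

section
/- Let G be a finite simple graph whose vertex set is partitioned as V = O ⊔ N ("old" and "new" vertices), such that every edge of G has at least one endpoint in O, and assume |O| ≥ 6 and |N| = 2|O| − 4. Let δ assign to each edge of G a value with 0 < δ(e) ≤ π, and for each vertex w set C(w) = Σ_{e incident to w} (π − δ(e)) (the cone angle at w). If Σ_{w ∈ V} (2π − C(w)) = 4π (the Gauss–Bonnet condition for the sphere), then max_{w ∈ O} C(w) ≥ 3π − 6π/|O|; in particular some old vertex w ∈ O has C(w) ≥ 2π, and C(w) > 2π when |O| > 6. (This is the combinatorial core of Theorem 9.1: applied to the 1-skeleton of the stellation s(T) of a triangulation T of S², with O the vertices of T and N the stellation vertices, it shows s(T) cannot be the Delaunay triangulation, with respect to the cone points, of any Euclidean metric on S² all of whose cone points are positively curved.) -/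
open Finset Real

/-- Double counting: summing over the vertices of `S` the weights of their incident edges counts
each edge once for every endpoint in `S`. -/
lemma sum_sum_incident_eq {V : Type*} [DecidableEq V] (E : Finset (Sym2 V)) (S : Finset V)
    (f : Sym2 V → ℝ) :
    ∑ w ∈ S, ∑ e ∈ E.filter (fun e => w ∈ e), f e
      = ∑ e ∈ E, ((S.filter (fun w => w ∈ e)).card : ℝ) * f e := by
  simp_rw [Finset.sum_filter]
  rw [Finset.sum_comm]
  refine Finset.sum_congr rfl fun e _ => ?_
  rw [← Finset.sum_filter, Finset.sum_const, nsmul_eq_mul]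

/-- The weighted handshake lemma. -/
lemma sum_univ_incident_eq_two_mul {V : Type*} [Fintype V] [DecidableEq V] (G : SimpleGraph V)
    [DecidableRel G.Adj] (f : Sym2 V → ℝ) :
    ∑ w : V, ∑ e ∈ G.edgeFinset.filter (fun e => w ∈ e), f e
      = 2 * ∑ e ∈ G.edgeFinset, f e := by
  rw [sum_sum_incident_eq, Finset.mul_sum]
  refine Finset.sum_congr rfl fun e he => ?_
  congr 1
  induction e using Sym2.ind with
  | _ a b =>
    have hab : a ≠ b := (SimpleGraph.mem_edgeFinset.mp he : G.Adj a b).ne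
    have h : (Finset.univ.filter fun w => w ∈ s(a, b)) = {a, b} := by ext; simp
    rw [h, Finset.card_pair hab, Nat.cast_ofNat]

/-- If `O` is a vertex cover, the incident weights of the vertices of `O` sum to at least the
total weight of the edges. -/
lemma sum_edgeFinset_le_sum_incident {V : Type*} [Fintype V] [DecidableEq V] (G : SimpleGraph V)
    [DecidableRel G.Adj] (O : Finset V) (hO : ∀ a b : V, G.Adj a b → a ∈ O ∨ b ∈ O)
    (f : Sym2 V → ℝ) (hf : ∀ e ∈ G.edgeFinset, 0 ≤ f e) :
    ∑ e ∈ G.edgeFinset, f e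
      ≤ ∑ w ∈ O, ∑ e ∈ G.edgeFinset.filter (fun e => w ∈ e), f e := by
  rw [sum_sum_incident_eq]
  refine Finset.sum_le_sum fun e he => le_mul_of_one_le_left (hf e he) ?_
  rw [Nat.one_le_cast, Nat.one_le_iff_ne_zero, Finset.card_ne_zero]
  induction e using Sym2.ind with
  | _ a b =>
    rcases hO a b (SimpleGraph.mem_edgeFinset.mp he) with h | h
    · exact ⟨a, by simp [h]⟩
    · exact ⟨b, by simp [h]⟩

/-- **Combinatorial core of Theorem 9.1 (stellations are not Delaunay).** Let `G` be a
finite simple graph whose vertices are partitioned into "old" vertices `O` and "new"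
vertices `Oᶜ`, every edge having at least one old endpoint, with `|O| ≥ 6` and
`|Oᶜ| = 2|O| − 4`. Let `δ` assign to each edge a value in `(0, π]` and let the cone angle
of a vertex `w` be `C(w) = Σ_{e ∋ w} (π − δ(e))`. If `Σ_w (2π − C(w)) = 4π`
(Gauss–Bonnet for the sphere), then some old vertex has cone angle at least
`3π − 6π/|O|`; in particular some old vertex has cone angle at least `2π`, and strictly
greater than `2π` when `|O| > 6`. -/
theorem stellation_cone_angle
    (V : Type) [Fintype V] [DecidableEq V]
    (G : SimpleGraph V) [DecidableRel G.Adj]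
    (O : Finset V)
    (hold : ∀ a b : V, G.Adj a b → a ∈ O ∨ b ∈ O)
    (hO : 6 ≤ O.card)
    (hN : Oᶜ.card = 2 * O.card - 4)
    (δ : Sym2 V → ℝ)
    (hδ : ∀ e ∈ G.edgeFinset, 0 < δ e ∧ δ e ≤ π)
    (hGB : ∑ w : V,
        (2 * π - ∑ e ∈ G.edgeFinset.filter (fun e => w ∈ e), (π - δ e)) = 4 * π) :
    (∃ w ∈ O, 3 * π - 6 * π / O.card
        ≤ ∑ e ∈ G.edgeFinset.filter (fun e => w ∈ e), (π - δ e)) ∧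
    (∃ w ∈ O, 2 * π ≤ ∑ e ∈ G.edgeFinset.filter (fun e => w ∈ e), (π - δ e)) ∧
    (6 < O.card →
      ∃ w ∈ O, 2 * π < ∑ e ∈ G.edgeFinset.filter (fun e => w ∈ e), (π - δ e)) := by
  have hn : (6 : ℝ) ≤ O.card := by exact_mod_cast hO
  have hn0 : (0 : ℝ) < O.card := by linarith
  have hV : (Fintype.card V : ℝ) = 3 * O.card - 4 := by
    have h : Fintype.card V + 4 = 3 * O.card := by
      have := O.card_add_card_compl
      omega
    have h' : (Fintype.card V : ℝ) + 4 = 3 * O.card := by exact_mod_cast h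
    linarith
  rw [Finset.sum_sub_distrib, sum_univ_incident_eq_two_mul, Finset.sum_const, Finset.card_univ,
    nsmul_eq_mul, hV] at hGB
  have hcover := sum_edgeFinset_le_sum_incident G O hold (fun e => π - δ e)
    fun e he => sub_nonneg.mpr (hδ e he).2
  have hmean : ∑ _w ∈ O, (3 * π - 6 * π / O.card) = 3 * π * O.card - 6 * π := by
    rw [Finset.sum_const, nsmul_eq_mul]
    field_simp
  obtain ⟨w, hw, hle⟩ := Finset.exists_le_of_sum_le (Finset.card_pos.mp (by omega))
    (show ∑ _w ∈ O, (3 * π - 6 * π / O.card)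
      ≤ ∑ w ∈ O, ∑ e ∈ G.edgeFinset.filter (fun e => w ∈ e), (π - δ e) by
      rw [hmean]; linarith)
  refine ⟨⟨w, hw, hle⟩, ⟨w, hw, le_trans ?_ hle⟩, fun h6 => ⟨w, hw, lt_of_lt_of_le ?_ hle⟩⟩
  · have : 6 * π / O.card ≤ π := by
      rw [div_le_iff₀ hn0]
      nlinarith [Real.pi_pos]
    linarith
  · have h6' : (6 : ℝ) < O.card := by exact_mod_cast h6
    have : 6 * π / O.card < π := by
      rw [div_lt_iff₀ hn0]
      nlinarith [Real.pi_pos]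
    linarith
end

section
/- Suppose combinatorial ideal-triangulation data admits a weak linear hyperbolic structure. Then for every u : S → ℝ and i : E → ℝ satisfying i(e₁(s,j)) + i(e₂(s,j)) ≤ u(s) for all s ∈ S and j ∈ {0,1,2}, one has Σ_{e ∈ E} i(e) − (1/2)·Σ_{s ∈ S} u(s) ≤ 0. (This is the linear-programming core of the first part of Theorem 10.1: taking, for a normal surface 𝒮 in an ideally triangulated 3-manifold (M³, T), u(s) to be the number of triangle pieces plus twice the number of quadrilateral pieces of 𝒮 in the tetrahedron s and i(e) the number of intersections of 𝒮 with the edge e, so that χ(𝒮) = Σ_e i(e) − ½ Σ_s u(s), it shows that if (M³, T) admits a weak linear hyperbolic structure then every normal surface has nonpositive Euler characteristic.) -/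
open Finset Real

/-- **Linear-programming core of the first part of Theorem 10.1.** Suppose combinatorial
ideal-triangulation data `(S, E, e₁, e₂)` admits a weak linear hyperbolic structure: an
`α : S × Fin 3 → ℝ` with `α ≥ 0`, angle sum `π` in each tetrahedron, and total angle `2π`
around each edge. Then for every `u : S → ℝ` and `i : E → ℝ` satisfying
`i(e₁(s,j)) + i(e₂(s,j)) ≤ u(s)` for all `s, j`, one has
`Σ_e i(e) − ½·Σ_s u(s) ≤ 0` (so every normal surface has nonpositive Euler
characteristic). -/
theorem weak_linear_hyperbolic_euler_nonpos
    (S E : Type) [Fintype S] [Fintype E] [DecidableEq E]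
    (e₁ e₂ : S × Fin 3 → E)
    (hweak : ∃ α : S × Fin 3 → ℝ,
      (∀ sj : S × Fin 3, 0 ≤ α sj) ∧
      (∀ s : S, ∑ j : Fin 3, α (s, j) = π) ∧
      (∀ e : E, ∑ sj : S × Fin 3,
          (((if e₁ sj = e then (1 : ℝ) else 0) + (if e₂ sj = e then (1 : ℝ) else 0))
            * α sj) = 2 * π)) :
    ∀ (u : S → ℝ) (i : E → ℝ),
      (∀ (s : S) (j : Fin 3), i (e₁ (s, j)) + i (e₂ (s, j)) ≤ u s) →
      (∑ e : E, i e) - (1 / 2) * (∑ s : S, u s) ≤ 0 := by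
  obtain ⟨α, hα, hs, he⟩ := hweak
  intro u i hu
  have edge_sum : (∑ e, i e) * (2 * π) = ∑ sj, (i (e₁ sj) + i (e₂ sj)) * α sj := by
    calc (∑ e, i e) * (2 * π)
        = ∑ e, ∑ sj, i e * (((if e₁ sj = e then (1 : ℝ) else 0)
            + (if e₂ sj = e then (1 : ℝ) else 0)) * α sj) := by
          rw [Finset.sum_mul]
          exact Finset.sum_congr rfl fun e _ => by rw [← he e, Finset.mul_sum]
      _ = ∑ sj, (i (e₁ sj) + i (e₂ sj)) * α sj := by
          rw [Finset.sum_comm]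
          refine Finset.sum_congr rfl fun sj _ => ?_
          simp only [← mul_assoc]
          rw [← Finset.sum_mul]
          simp [mul_add, Finset.sum_add_distrib]
  have tetrahedron_sum : (∑ s, u s) * π = ∑ sj : S × Fin 3, u sj.1 * α sj := by
    rw [Fintype.sum_prod_type, Finset.sum_mul]
    exact Finset.sum_congr rfl fun s _ => by rw [← hs s, Finset.mul_sum]
  have key : (∑ e, i e) * (2 * π) ≤ (∑ s, u s) * π := by
    rw [edge_sum, tetrahedron_sum]
    exact Finset.sum_le_sum fun sj _ => mul_le_mul_of_nonneg_right (hu sj.1 sj.2) (hα sj)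
  have : 2 * (∑ e, i e) ≤ ∑ s, u s :=
    le_of_mul_le_mul_right (by linarith) Real.pi_pos
  linarith
end

section
/- Suppose combinatorial ideal-triangulation data admits a linear hyperbolic structure (all angles strictly positive). Then for every u : S → ℝ and i : E → ℝ satisfying i(e₁(s,j)) + i(e₂(s,j)) ≤ u(s) for all s ∈ S and j ∈ {0,1,2}, with strict inequality for at least one pair (s,j), one has Σ_{e ∈ E} i(e) − (1/2)·Σ_{s ∈ S} u(s) < 0. (This is the linear-programming core of the second part of Theorem 10.1: for a normal surface 𝒮 that is not a union of boundary-parallel tori, some piece is a quadrilateral, which makes one of the constraints strict; hence if (M³, T) admits a linear hyperbolic structure, every non-boundary-parallel normal surface has strictly negative Euler characteristic χ(𝒮) = Σ_e i(e) − ½ Σ_s u(s).) -/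
open Finset Real

/-- **Linear-programming core of the second part of Theorem 10.1.** Suppose combinatorial
ideal-triangulation data `(S, E, e₁, e₂)` admits a linear hyperbolic structure: an
`α : S × Fin 3 → ℝ` with `α > 0`, angle sum `π` in each tetrahedron, and total angle `2π`
around each edge. Then for every `u : S → ℝ` and `i : E → ℝ` satisfying
`i(e₁(s,j)) + i(e₂(s,j)) ≤ u(s)` for all `s, j`, with strict inequality for at least one
pair `(s, j)`, one has `Σ_e i(e) − ½·Σ_s u(s) < 0` (so every non-boundary-parallel
normal surface has strictly negative Euler characteristic). -/
theorem linear_hyperbolic_euler_neg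
    (S E : Type) [Fintype S] [Fintype E] [DecidableEq E]
    (e₁ e₂ : S × Fin 3 → E)
    (hstrong : ∃ α : S × Fin 3 → ℝ,
      (∀ sj : S × Fin 3, 0 < α sj) ∧
      (∀ s : S, ∑ j : Fin 3, α (s, j) = π) ∧
      (∀ e : E, ∑ sj : S × Fin 3,
          (((if e₁ sj = e then (1 : ℝ) else 0) + (if e₂ sj = e then (1 : ℝ) else 0))
            * α sj) = 2 * π)) :
    ∀ (u : S → ℝ) (i : E → ℝ),
      (∀ (s : S) (j : Fin 3), i (e₁ (s, j)) + i (e₂ (s, j)) ≤ u s) →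
      (∃ (s : S) (j : Fin 3), i (e₁ (s, j)) + i (e₂ (s, j)) < u s) →
      (∑ e : E, i e) - (1 / 2) * (∑ s : S, u s) < 0 := by
  obtain ⟨α, hpos, htet, hedge⟩ := hstrong
  rintro u i hle ⟨s₀, j₀, hlt⟩
  have hedges : ∑ sj : S × Fin 3, (i (e₁ sj) + i (e₂ sj)) * α sj = 2 * π * ∑ e, i e := by
    calc ∑ sj : S × Fin 3, (i (e₁ sj) + i (e₂ sj)) * α sj
        = ∑ sj : S × Fin 3, ∑ e, i e * (((if e₁ sj = e then (1 : ℝ) else 0)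
            + (if e₂ sj = e then (1 : ℝ) else 0)) * α sj) := by
          refine sum_congr rfl fun sj _ => ?_
          simp [add_mul, mul_add, sum_add_distrib]
      _ = ∑ e, i e * (2 * π) := by
          rw [sum_comm]
          exact sum_congr rfl fun e _ => by rw [← mul_sum, hedge e]
      _ = 2 * π * ∑ e, i e := by rw [← sum_mul, mul_comm]
  have htets : ∑ sj : S × Fin 3, u sj.1 * α sj = π * ∑ s, u s := by
    rw [Fintype.sum_prod_type, mul_sum]
    exact sum_congr rfl fun s _ => by simp only [← mul_sum, htet s, mul_comm]
  have hsum : ∑ sj : S × Fin 3, (i (e₁ sj) + i (e₂ sj)) * α sj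
      < ∑ sj : S × Fin 3, u sj.1 * α sj :=
    sum_lt_sum (fun sj _ => mul_le_mul_of_nonneg_right (hle sj.1 sj.2) (hpos sj).le)
      ⟨(s₀, j₀), mem_univ _, mul_lt_mul_of_pos_right hlt (hpos _)⟩
  rw [hedges, htets] at hsum
  have hlt_sum : 2 * ∑ e, i e < ∑ s, u s :=
    lt_of_mul_lt_mul_left (by linarith) pi_pos.le
  linarith
end
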